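/- Let r > 0 and k >= 0 be integers, q a prime power, and n a positive integer such that r divides q^n - 1 and there exists a polynomial g in P_k. If q^{n/2 - ϑ} > 2·r·rad(r)·W(x^n - 1)·W(R)·W(G), where ϑ = 2k if gcd(q, n) = 1 and ϑ = 3k otherwise, then there exists a pair (α, α^{-1}) of r-primitive k-normal elements in F_{q^n} over F_q, i.e., an α in F_{q^n}* such that both α and α^{-1} are simultaneously r-primitive and k-normal over F_q. -/

import Mathlib

open Polynomial UniqueFactorizationMonoid
open scoped Classical

noncomputable section

/-- The action `h ∘ β = Σ_i a_i β^{q^i}` of a polynomial `h = Σ_i a_i x^i` over `F_q`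
on an element `β` of an extension field. -/
def polyAct {Fq F : Type*} [Field Fq] [Field F] [Algebra Fq F]
    (q : ℕ) (h : Fq[X]) (β : F) : F :=
  h.sum fun i a => algebraMap Fq F a * β ^ q ^ i

/-- `h` is the `F_q`-order of `β`: the monic divisor of `x^n - 1` of least degree
annihilating `β`. -/
def IsFqOrder {Fq F : Type*} [Field Fq] [Field F] [Algebra Fq F]
    (q n : ℕ) (h : Fq[X]) (β : F) : Prop :=
  h.Monic ∧ h ∣ (X ^ n - 1 : Fq[X]) ∧ polyAct q h β = 0 ∧
    ∀ h' : Fq[X], h'.Monic → h' ∣ (X ^ n - 1 : Fq[X]) → polyAct q h' β = 0 →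
      h.natDegree ≤ h'.natDegree

/-- `α` is `k`-normal over `F_q`: its `F_q`-order has degree `n - k`. -/
def IsKNormal (Fq : Type*) {F : Type*} [Field Fq] [Field F] [Algebra Fq F]
    (q n k : ℕ) (α : F) : Prop :=
  ∃ h : Fq[X], IsFqOrder q n h α ∧ h.natDegree = n - k

/-- `β` is `h`-free: `gcd(h, (x^n - 1)/Ord_q(β)) = 1`. -/
def IsPolyFree {Fq F : Type*} [Field Fq] [Field F] [Algebra Fq F]
    (q n : ℕ) (h : Fq[X]) (β : F) : Prop :=
  ∃ f : Fq[X], IsFqOrder q n f β ∧ IsCoprime h ((X ^ n - 1 : Fq[X]) / f)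

/-- `rad(m)`: product of the distinct primes dividing `m`. -/
def radN (m : ℕ) : ℕ := ∏ p ∈ m.primeFactors, p

/-- `W(m)`: number of squarefree divisors of `m`. -/
def Wnat (m : ℕ) : ℕ := (m.divisors.filter Squarefree).card

/-- `rad(f)`: product of the distinct monic irreducible factors of `f`. -/
def radPoly {Fq : Type*} [Field Fq] (f : Fq[X]) : Fq[X] :=
  (normalizedFactors f).toFinset.prod id

/-- `W(f)`: number of monic squarefree divisors of `f`. -/
def Wpoly {Fq : Type*} [Field Fq] (f : Fq[X]) : ℕ :=
  {g : Fq[X] | g.Monic ∧ Squarefree g ∧ g ∣ f}.ncard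

/-- The primes `p_1, …, p_s` in the decomposition `r = u·p_1^{b_1}···p_s^{b_s}`:
primes `p ∣ r` such that `p^{b_p + 1} ∣ M` where `b_p` is the multiplicity of `p`
in `r` (here `M = q^n - 1`). -/
def rBadPrimes (r M : ℕ) : Finset ℕ :=
  r.primeFactors.filter fun p => p ^ (r.factorization p + 1) ∣ M

/-- `Q_r^d`: the set of `α ∈ F_{q^n}^*` that are `d`-free, are `r`-th powers, but are
not `λ_j = p_j^{b_j+1}`-th powers for any of the primes `p_j` in the decomposition
of `r`. -/
def QSet (F : Type*) [Field F] (q n r d : ℕ) : Set F :=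
  {α | α ≠ 0 ∧ Nat.gcd d ((q ^ n - 1) / orderOf α) = 1 ∧
    (∃ β : F, β ^ r = α) ∧
    ∀ p ∈ rBadPrimes r (q ^ n - 1), ∀ β : F, β ^ p ^ (r.factorization p + 1) ≠ α}

/-- The irreducible factors `f_1, …, f_t` in the decomposition
`g = π·f_1^{b_1}···f_t^{b_t}`: monic irreducible `f ∣ g` with `f^{b_f + 1} ∣ M`
where `b_f` is the multiplicity of `f` in `g` (here `M = x^n - 1`). -/
def gBadFactors {Fq : Type*} [Field Fq] (g M : Fq[X]) : Finset (Fq[X]) :=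
  (normalizedFactors g).toFinset.filter
    fun f => f ^ ((normalizedFactors g).count f + 1) ∣ M

/-- `T_{g,k}^H`: the set of `α ∈ F_{q^n}` that are `H`-free, of the form `g∘β`, but
not of the form `Λ_i∘β` for `Λ_i = f_i^{b_i+1}`. -/
def TSet {Fq : Type*} (F : Type*) [Field Fq] [Field F] [Algebra Fq F]
    (q n : ℕ) (g H : Fq[X]) : Set F :=
  {α | IsPolyFree q n H α ∧ (∃ β : F, polyAct q g β = α) ∧
    ∀ f ∈ gBadFactors g (X ^ n - 1 : Fq[X]), ∀ β : F,
      polyAct q (f ^ ((normalizedFactors g).count f + 1)) β ≠ α}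

/-- `N_{r,k,g}(h, d, H)`: the number of `β ∈ F_{q^n}` such that `β` is `h`-free,
`g∘β ∈ Q_r^d` and `(g∘β)⁻¹ ∈ T_{g,k}^H`. -/
def Ncnt {Fq : Type*} (F : Type*) [Field Fq] [Field F] [Algebra Fq F]
    (q n r : ℕ) (g h : Fq[X]) (d : ℕ) (H : Fq[X]) : ℕ :=
  {β : F | IsPolyFree q n h β ∧ polyAct q g β ∈ QSet F q n r d ∧
    (polyAct q g β)⁻¹ ∈ TSet F q n g H}.ncard

/-- Stepanov's method in abstract form: auxiliary polynomials `P i` of pairwise distinct degrees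
whose `Q`-th powers agree on `Z`, up to a common factor, with polynomials `T i` from a space of
dimension less than the number of indices. -/
lemma card_le_of_pow_eval_eq {K ι : Type*} [Field K] [Fintype K] [Fintype ι]
    (p s B N : ℕ) [Fact p.Prime] [CharP K p] (hcard : Fintype.card K = p ^ s * p ^ s)
    (Z : Finset K) (P T : ι → K[X]) (y : K → K)
    (hPT : ∀ x ∈ Z, ∀ i, (P i).eval x ^ p ^ s = y x * (T i).eval x)
    (hP0 : ∀ i, P i ≠ 0) (hPinj : Function.Injective fun i => (P i).natDegree)
    (hPB : ∀ i, (P i).natDegree ≤ B) (hT : ∀ i, (T i).degree < N)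
    (hN : N < Fintype.card ι) : Z.card ≤ B := by
  let Φ : (ι → K) →ₗ[K] degreeLT K N :=
    Fintype.linearCombination K (fun i => (⟨T i, mem_degreeLT.2 (hT i)⟩ : degreeLT K N))
  have hker : LinearMap.ker Φ ≠ ⊥ := by
    apply LinearMap.ker_ne_bot_of_finrank_lt
    rw [(degreeLTEquiv K N).finrank_eq]
    simpa using hN
  obtain ⟨c, hc, hc0⟩ := (Submodule.ne_bot_iff _).1 hker
  have hc' : ∑ i, C (c i) * T i = 0 := by
    have := congrArg Subtype.val (LinearMap.mem_ker.1 hc)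
    simpa [Φ, Fintype.linearCombination_apply, Submodule.coe_sum, smul_eq_C_mul] using this
  have hpow : ∀ x : K, (x ^ p ^ s) ^ p ^ s = x := fun x => by
    rw [← pow_mul, ← hcard, FiniteField.pow_card]
  let R : K[X] := ∑ i, C (c i ^ p ^ s) * P i
  have hdeg : ∀ i, c i ≠ 0 → (C (c i ^ p ^ s) * P i).degree = (P i).degree := fun i hi =>
    degree_C_mul (pow_ne_zero _ hi)
  have hRdeg : R.degree = Finset.univ.sup fun i => (C (c i ^ p ^ s) * P i).degree := by
    apply degree_sum_eq_of_disjoint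
    intro i hi j hj hij
    have hci : c i ≠ 0 := fun h => hi.2 (by simp [h, (Fact.out : p.Prime).ne_zero])
    have hcj : c j ≠ 0 := fun h => hj.2 (by simp [h, (Fact.out : p.Prime).ne_zero])
    simp only [Function.onFun, Function.comp, hdeg i hci, hdeg j hcj]
    intro h
    exact hij (hPinj (natDegree_eq_of_degree_eq h))
  have hR0 : R ≠ 0 := by
    obtain ⟨i, hi⟩ := Function.ne_iff.1 hc0
    intro h
    rw [h, degree_zero, eq_comm, Finset.sup_eq_bot_iff] at hRdeg
    have := hRdeg i (Finset.mem_univ _)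
    rw [hdeg i hi, degree_eq_bot] at this
    exact hP0 i this
  have hRB : R.natDegree ≤ B :=
    natDegree_sum_le_of_forall_le _ _ fun i _ => (natDegree_C_mul_le _ _).trans (hPB i)
  refine le_trans ?_ ((card_roots' R).trans hRB)
  have hsub : Z ⊆ R.roots.toFinset := by
    intro x hx
    rw [Multiset.mem_toFinset, mem_roots hR0, IsRoot.def]
    apply pow_eq_zero_iff (n := p ^ s) (pow_ne_zero _ (Fact.out : p.Prime).ne_zero) |>.1
    have h1 : R.eval x ^ p ^ s = ∑ i, c i * (y x * (T i).eval x) := by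
      simp only [R, eval_finsetSum, eval_mul, eval_C]
      rw [sum_pow_char_pow]
      refine Finset.sum_congr rfl fun i _ => ?_
      rw [mul_pow, hpow, hPT x hx]
    have h2 : ∑ i, c i * (T i).eval x = 0 := by
      have := congrArg (eval x) hc'
      simpa [eval_finsetSum] using this
    rw [h1]
    calc _ = y x * ∑ i, c i * (T i).eval x := by
          rw [Finset.mul_sum]; exact Finset.sum_congr rfl fun i _ => by ring
      _ = 0 := by rw [h2, mul_zero]
  exact (Finset.card_le_card hsub).trans (Multiset.toFinset_card_le _)

lemma exponent_injective (e g p₁ A : ℕ) (he : 2 ≤ e) (hg : g * (e - 1) + 1 = e * p₁)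
    (hA : (e - 1) * A ≤ p₁) {i i' j j' l l' s s' : ℕ} (hi : i < e - 1) (hi' : i' < e - 1)
    (hj : j < e) (hj' : j' < e) (hs : s < A) (hs' : s' < A)
    (h : s + g * i + p₁ * j + l * (e * p₁) = s' + g * i' + p₁ * j' + l' * (e * p₁)) :
    i = i' ∧ j = j' ∧ l = l' ∧ s = s' := by
  obtain ⟨d, rfl⟩ : ∃ d, e = d + 1 := ⟨e - 1, by omega⟩
  simp only [Nat.add_sub_cancel] at *
  have hp : 0 < p₁ := by
    rcases Nat.eq_zero_or_pos p₁ with h0 | h0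
    · simp [h0] at hg
    · exact h0
  have key : ∀ {i j l s : ℕ}, i < d → s < A → d * (s + g * i + p₁ * j + l * ((d + 1) * p₁)) + d
      = p₁ * (i * (d + 1) + d * j + d * (d + 1) * l) + (d * s + (d - i)) := by
    intro i j l s hi _
    obtain ⟨f, rfl⟩ : ∃ f, d = i + f := ⟨d - i, by omega⟩
    simp only [Nat.add_sub_cancel_left]
    have : i * (g * (i + f) + 1) = i * ((i + f + 1) * p₁) := by rw [hg]
    nlinarith
  have hlt : ∀ {i s : ℕ}, i < d → s < A → d * s + (d - i) ≤ p₁ ∧ 0 < d * s + (d - i) := by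
    intro i s hi hs
    have : d * (s + 1) ≤ d * A := Nat.mul_le_mul_left _ hs
    constructor
    · have : d * s + d ≤ p₁ := by linarith
      omega
    · omega
  have h1 := key (j := j) (l := l) hi hs
  have h2 := key (j := j') (l := l') hi' hs'
  rw [h, h2] at h1
  obtain ⟨a1, a2⟩ := hlt hi hs
  obtain ⟨b1, b2⟩ := hlt hi' hs'
  set u := i * (d + 1) + d * j + d * (d + 1) * l
  set u' := i' * (d + 1) + d * j' + d * (d + 1) * l'
  have hu : u' = u := by
    rcases lt_trichotomy u' u with hlt | heq | hlt
    · have : p₁ * (u' + 1) ≤ p₁ * u := Nat.mul_le_mul_left _ hlt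
      rw [mul_add] at this; omega
    · exact heq
    · have : p₁ * (u + 1) ≤ p₁ * u' := Nat.mul_le_mul_left _ hlt
      rw [mul_add] at this; omega
  rw [hu] at h1
  have h3 : d * s' + (d - i') = d * s + (d - i) := by omega
  have hs : s' = s := by
    rcases lt_trichotomy s' s with hlt | heq | hlt
    · have : d * (s' + 1) ≤ d * s := Nat.mul_le_mul_left _ hlt
      rw [mul_add] at this; omega
    · exact heq
    · have : d * (s + 1) ≤ d * s' := Nat.mul_le_mul_left _ hlt
      rw [mul_add] at this; omega
  subst hs
  have hii : i = i' := by omega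
  subst hii
  have h4 : d * (j' + (d + 1) * l') = d * (j + (d + 1) * l) := by
    simp only [u, u'] at hu
    linarith
  have h5 := Nat.eq_of_mul_eq_mul_left (by omega) h4
  have hll : l' = l := by
    rcases lt_trichotomy l' l with hlt | heq | hlt
    · have : (d + 1) * (l' + 1) ≤ (d + 1) * l := Nat.mul_le_mul_left _ hlt
      rw [mul_add] at this; omega
    · exact heq
    · have : (d + 1) * (l + 1) ≤ (d + 1) * l' := Nat.mul_le_mul_left _ hlt
      rw [mul_add] at this; omega
  subst hll
  exact ⟨rfl, by omega, rfl, rfl⟩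

/-- `x ^ e ^ (m - 1)` times the partial trace `Σ_{i < m} (a x + b / x) ^ e ^ i`, as a polynomial. -/
def partialTracePoly {K : Type*} [Field K] (e m : ℕ) (a b : K) : K[X] :=
  ∑ i ∈ Finset.range m, (C (a ^ e ^ i) * X ^ (e ^ (m - 1) + e ^ i) +
    C (b ^ e ^ i) * X ^ (e ^ (m - 1) - e ^ i))

lemma natDegree_partialTracePoly {K : Type*} [Field K] {e m : ℕ} (he : 2 ≤ e) (hm : 0 < m)
    {a b : K} (ha : a ≠ 0) : (partialTracePoly e m a b).natDegree = 2 * e ^ (m - 1) := by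
  have hpos : ∀ i, 0 < e ^ i := fun i => by positivity
  have hle : ∀ i ∈ Finset.range m, e ^ i ≤ e ^ (m - 1) := fun i hi =>
    Nat.pow_le_pow_right (by omega) (by have := Finset.mem_range.1 hi; omega)
  apply natDegree_eq_of_le_of_coeff_ne_zero
  · apply natDegree_sum_le_of_forall_le
    intro i hi
    have := hle i hi
    refine (natDegree_add_le _ _).trans (max_le ?_ ?_)
    · exact (natDegree_C_mul_X_pow_le _ _).trans (by omega)
    · exact (natDegree_C_mul_X_pow_le _ _).trans (by omega)
  · have : (partialTracePoly e m a b).coeff (2 * e ^ (m - 1)) = a ^ e ^ (m - 1) := by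
      rw [partialTracePoly, finsetSum_coeff, Finset.sum_eq_single (m - 1)]
      · have h := hpos (m - 1)
        rw [coeff_add, coeff_C_mul_X_pow, coeff_C_mul_X_pow, if_pos (by omega), if_neg (by omega),
          add_zero]
      · intro i hi hne
        have h1 : e ^ i < e ^ (m - 1) :=
          Nat.pow_lt_pow_right (by omega) (by have := Finset.mem_range.1 hi; omega)
        rw [coeff_add, coeff_C_mul_X_pow, coeff_C_mul_X_pow, if_neg (by omega), if_neg (by omega),
          add_zero]
      · intro h; exact absurd (Finset.mem_range.2 (by omega)) h
    rw [this]
    exact pow_ne_zero _ ha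

lemma eval_partialTracePoly {K : Type*} [Field K] (p f : ℕ) [Fact p.Prime] [CharP K p]
    (m : ℕ) (a b : K) {x : K} (hx : x ≠ 0) :
    (partialTracePoly (p ^ f) m a b).eval x =
      x ^ (p ^ f) ^ (m - 1) * ∑ i ∈ Finset.range m, (a * x + b * x⁻¹) ^ (p ^ f) ^ i := by
  rw [partialTracePoly, eval_finsetSum, Finset.mul_sum]
  refine Finset.sum_congr rfl fun i hi => ?_
  have hle : (p ^ f) ^ i ≤ (p ^ f) ^ (m - 1) :=
    Nat.pow_le_pow_right (pow_pos (Fact.out : p.Prime).pos _)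
      (by have := Finset.mem_range.1 hi; omega)
  have h1 : (a * x + b * x⁻¹) ^ (p ^ f) ^ i =
      a ^ (p ^ f) ^ i * x ^ (p ^ f) ^ i + b ^ (p ^ f) ^ i * (x ^ (p ^ f) ^ i)⁻¹ := by
    rw [← pow_mul p f i, add_pow_char_pow, mul_pow, mul_pow, inv_pow]
  rw [h1]
  simp only [eval_add, eval_mul, eval_C, eval_pow, eval_X]
  rw [pow_add, pow_sub₀ _ hx hle]
  ring

lemma card_fiber_le_of_lt {K : Type*} [Field K] [Fintype K] (p f m A L : ℕ) [Fact p.Prime]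
    [CharP K p] (hf : 0 < f) (hm : 0 < m) (hcard : Fintype.card K = (p ^ f) ^ m * (p ^ f) ^ m)
    (a b u t : K) (ha : a ≠ 0) (hA : (p ^ f - 1) * A ≤ (p ^ f) ^ (m - 1))
    (hAL : (p ^ f) ^ m * (A + 2) + L < p ^ f * (p ^ f - 1) * L * A) (Z : Finset K)
    (hZ0 : ∀ x ∈ Z, x ≠ 0)
    (hZu : ∀ x ∈ Z, x ^ (∑ i ∈ Finset.range m, (p ^ f) ^ i) *
      (x ^ (∑ i ∈ Finset.range m, (p ^ f) ^ i)) ^ (p ^ f) ^ m = u)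
    (hZt : ∀ x ∈ Z, (∑ i ∈ Finset.range m, (a * x + b * x⁻¹) ^ (p ^ f) ^ i) +
      (∑ i ∈ Finset.range m, (a * x + b * x⁻¹) ^ (p ^ f) ^ i) ^ (p ^ f) ^ m = t) :
    Z.card ≤ A + (L + 2) * (p ^ f) ^ m := by
  have he : 2 ≤ p ^ f := by
    calc 2 ≤ p := (Fact.out : p.Prime).two_le
      _ ≤ p ^ f := Nat.le_self_pow hf.ne' p
  have heval : ∀ x : K, x ≠ 0 → _ := fun x hx => eval_partialTracePoly p f m a b hx
  generalize hedef : p ^ f = e at *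
  set g := ∑ i ∈ Finset.range m, e ^ i with hgdef
  set p₁ := e ^ (m - 1) with hp₁
  have hq : e ^ m = e * p₁ := by rw [hp₁, ← pow_succ']; congr 1; omega
  have hg : g * (e - 1) + 1 = e * p₁ := by
    rw [← hq, hgdef]
    obtain ⟨d, rfl⟩ : ∃ d, e = d + 1 := ⟨e - 1, by omega⟩
    simpa using geom_sum_mul_add d m
  have hgle : g * (e - 2) ≤ e * p₁ := by
    have : g * (e - 2) ≤ g * (e - 1) := Nat.mul_le_mul_left _ (by omega)
    omega
  have hqs : e ^ m = p ^ (f * m) := by rw [← hedef, ← pow_mul]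
  set V := partialTracePoly e m a b with hV
  have hVdeg : V.natDegree = 2 * p₁ := natDegree_partialTracePoly he hm ha
  have hV0 : V ≠ 0 := by
    intro h
    rw [h, natDegree_zero] at hVdeg
    have : 0 < e ^ (m - 1) := by positivity
    omega
  let P : Fin (e - 1) × Fin e × Fin L × Fin A → K[X] := fun i =>
    X ^ ((i.2.2.2 : ℕ) + g * i.1 + (e - 1 - i.2.1) * p₁ + i.2.2.1 * e ^ m) * V ^ (i.2.1 : ℕ)
  let T : Fin (e - 1) × Fin e × Fin L × Fin A → K[X] := fun i =>
    C (u ^ (i.1 : ℕ)) * X ^ (e ^ m * i.2.2.2 + g * (e - 2 - i.1) + (e - 1 - i.2.1) * p₁ + i.2.2.1) *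
      (C t * X ^ p₁ - V) ^ (i.2.1 : ℕ)
  have hPdeg : ∀ i, (P i).natDegree =
      ((i.2.2.2 : ℕ) + g * i.1 + p₁ * i.2.1 + i.2.2.1 * (e * p₁)) + (e - 1) * p₁ := by
    rintro ⟨⟨i, hi⟩, ⟨j, hj⟩, ⟨l, hl⟩, ⟨s, hs⟩⟩
    obtain ⟨c, hc⟩ : ∃ c, e - 1 = j + c := ⟨e - 1 - j, by omega⟩
    simp only [P]
    rw [natDegree_mul (pow_ne_zero _ X_ne_zero) (pow_ne_zero _ hV0), natDegree_X_pow,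
      natDegree_pow, hVdeg, hc, Nat.add_sub_cancel_left, hq]
    ring
  refine card_le_of_pow_eval_eq (ι := Fin (e - 1) × Fin e × Fin L × Fin A) p (f * m)
    (A + (L + 2) * e ^ m) (e ^ m * (A + 2) + L) (hqs ▸ hcard) Z P T
    (fun x => x ^ (e ^ m * ((e - 1) * p₁)) * (x ^ (g * (e - 2) + (e - 1) * p₁))⁻¹) ?_ ?_ ?_ ?_ ?_ ?_
  · rintro x hx ⟨⟨i, hi⟩, ⟨j, hj⟩, ⟨l, hl⟩, ⟨s, hs⟩⟩
    have hx0 := hZ0 x hx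
    set v := ∑ i ∈ Finset.range m, (a * x + b * x⁻¹) ^ e ^ i with hv
    set w := x ^ g with hw
    have hw0 : w ≠ 0 := pow_ne_zero _ hx0
    have hVx : V.eval x = x ^ p₁ * v := heval x hx0
    have hwq : w ^ e ^ m = u * w⁻¹ := by
      rw [eq_mul_inv_iff_mul_eq₀ hw0, mul_comm]; exact hZu x hx
    have hvq : v ^ e ^ m = t - v := by rw [← hZt x hx]; ring
    have hxq : (x ^ e ^ m) ^ e ^ m = x := by rw [← pow_mul, ← hcard, FiniteField.pow_card]
    obtain ⟨c, hc⟩ : ∃ c, e - 1 = j + c := ⟨e - 1 - j, by omega⟩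
    obtain ⟨d, hd⟩ : ∃ d, e - 2 = i + d := ⟨e - 2 - i, by omega⟩
    simp only [P, T, eval_mul, eval_pow, eval_X, eval_C, eval_sub, hVx, ← hqs]
    rw [hc, hd, Nat.add_sub_cancel_left, Nat.add_sub_cancel_left]
    have e1 : (x ^ (s + g * i + c * p₁ + l * e ^ m) * (x ^ p₁ * v) ^ j) ^ e ^ m =
        x ^ (e ^ m * s) * (w ^ e ^ m) ^ i * x ^ (e ^ m * (c * p₁)) *
          ((x ^ e ^ m) ^ e ^ m) ^ l * x ^ (e ^ m * (p₁ * j)) * (v ^ e ^ m) ^ j := by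
      rw [hw]; ring
    have e2 : t * x ^ p₁ - x ^ p₁ * v = x ^ p₁ * (t - v) := by ring
    have e3 : x ^ (g * (i + d) + (j + c) * p₁) =
        w ^ i * w ^ d * x ^ (p₁ * j) * x ^ (p₁ * c) := by rw [hw]; ring
    have e4 : x ^ (e ^ m * s + g * d + c * p₁ + l) =
        x ^ (e ^ m * s) * w ^ d * x ^ (p₁ * c) * x ^ l := by rw [hw]; ring
    rw [e1, e2, e3, e4, hwq, hvq, hxq, mul_pow, mul_pow, ← pow_mul, inv_pow]
    field_simp
    ring
  · intro i
    exact mul_ne_zero (pow_ne_zero _ X_ne_zero) (pow_ne_zero _ hV0)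
  · rintro ⟨i, j, l, s⟩ ⟨i', j', l', s'⟩ h
    simp only [hPdeg, Nat.add_right_cancel_iff] at h
    obtain ⟨h1, h2, h3, h4⟩ := exponent_injective e g p₁ A he hg hA i.2 i'.2 j.2 j'.2 s.2 s'.2 h
    simp only [Prod.mk.injEq, Fin.ext_iff]
    exact ⟨h1, h2, h3, h4⟩
  · rintro ⟨⟨i, hi⟩, ⟨j, hj⟩, ⟨l, hl⟩, ⟨s, hs⟩⟩
    rw [hPdeg, hq]
    simp only
    have h1 : g * i ≤ g * (e - 2) := Nat.mul_le_mul_left _ (by omega)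
    have h2 : p₁ * j ≤ p₁ * e := Nat.mul_le_mul_left _ hj.le
    have h3 : (l + 1) * (e * p₁) ≤ L * (e * p₁) := Nat.mul_le_mul_right _ hl
    have h4 : (e - 1) * p₁ ≤ e * p₁ := Nat.mul_le_mul_right _ (by omega)
    nlinarith
  · rintro ⟨⟨i, hi⟩, ⟨j, hj⟩, ⟨l, hl⟩, ⟨s, hs⟩⟩
    refine lt_of_le_of_lt degree_le_natDegree (Nat.cast_lt.2 ?_)
    have hW : (C t * X ^ p₁ - V).natDegree ≤ 2 * p₁ :=
      (natDegree_sub_le _ _).trans (max_le ((natDegree_C_mul_X_pow_le _ _).trans (by omega)) hVdeg.le)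
    have h0 : (T (⟨i, hi⟩, ⟨j, hj⟩, ⟨l, hl⟩, ⟨s, hs⟩)).natDegree ≤
        (e ^ m * s + g * (e - 2 - i) + (e - 1 - j) * p₁ + l) + j * (2 * p₁) := by
      refine natDegree_mul_le.trans (add_le_add (natDegree_C_mul_X_pow_le _ _) ?_)
      exact natDegree_pow_le.trans (Nat.mul_le_mul_left _ hW)
    refine lt_of_le_of_lt h0 ?_
    have h1 : g * (e - 2 - i) ≤ g * (e - 2) := Nat.mul_le_mul_left _ (by omega)
    have h2 : e ^ m * (s + 1) ≤ e ^ m * A := Nat.mul_le_mul_left _ hs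
    obtain ⟨c, hc⟩ : ∃ c, e = j + c + 1 := ⟨e - 1 - j, by omega⟩
    have h3 : e - 1 - j = c := by omega
    rw [h3]
    have h4 : c * p₁ + j * (2 * p₁) ≤ 2 * (e * p₁) := by
      rw [show e * p₁ = (j + c + 1) * p₁ by rw [← hc]]; nlinarith
    rw [hq] at h2 ⊢
    linarith
  · simp only [Fintype.card_prod, Fintype.card_fin]
    calc _ < e * (e - 1) * L * A := hAL
      _ = _ := by ring

lemma stepanov_parameters {e m : ℕ} (he : 2 ≤ e) (hm : 4 ≤ m) :
    ∃ A L : ℕ, (e - 1) * A ≤ e ^ (m - 1) ∧ e ^ m * (A + 2) + L < e * (e - 1) * L * A ∧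
      e * (e - 1) * (A + (L + 2) * e ^ m) ≤ e ^ m * e ^ m + 10 * (e * (e - 1)) * e ^ m := by
  obtain ⟨d, rfl⟩ : ∃ d, e = d + 1 := ⟨e - 1, by omega⟩
  simp only [Nat.add_sub_cancel]
  set p₁ := (d + 1) ^ (m - 1) with hp₁
  have hq : (d + 1) ^ m = (d + 1) * p₁ := by rw [hp₁, ← pow_succ']; congr 1; omega
  rw [hq]
  have hd : 1 ≤ d := by omega
  have hp3 : 2 * (d + 1) ^ 2 ≤ p₁ := by
    calc 2 * (d + 1) ^ 2 ≤ (d + 1) * (d + 1) ^ 2 := Nat.mul_le_mul_right _ he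
      _ = (d + 1) ^ 3 := by ring
      _ ≤ _ := Nat.pow_le_pow_right (by omega) (by omega)
  set q := (d + 1) * p₁ with hqdef
  have hq16 : 16 ≤ q := by nlinarith
  have hqd : 4 * (d + 1) ^ 2 ≤ q := by nlinarith
  set D := (d + 1) * d with hD
  have hD2 : 2 ≤ D := by nlinarith
  refine ⟨p₁ / d, q / D + 7, Nat.mul_div_le _ _, ?_, ?_⟩
  · set A := p₁ / d with hA
    have h1 : q < D * (q / D + 1) := Nat.lt_mul_div_succ q (by omega)
    have h2 : p₁ < d * (A + 1) := Nat.lt_mul_div_succ p₁ (by omega)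
    have h3 : q / D ≤ q / 2 := Nat.div_le_div_left hD2 (by omega)
    have h4 : 2 * (q / 2) ≤ q := Nat.mul_div_le _ _
    have h5 : q ≤ D * A + (d + 1) ^ 2 := by
      have : (d + 1) * p₁ ≤ (d + 1) * (d * (A + 1)) := Nat.mul_le_mul_left _ h2.le
      rw [hD]; nlinarith
    have h6 : q * A + 6 * (D * A) ≤ D * (q / D + 7) * A := by
      have : (q + 6 * D) * A ≤ D * (q / D + 7) * A := Nat.mul_le_mul_right _ (by nlinarith)
      linarith
    have h7 : q * (A + 2) + (q / D + 7) < q * A + 6 * (D * A) := by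
      nlinarith
    omega
  · have h1 : D * (q / D) ≤ q := Nat.mul_div_le _ _
    have h2 : p₁ / d ≤ q := (Nat.div_le_self _ _).trans (by nlinarith)
    have h3 : D * (p₁ / d) ≤ D * q := Nat.mul_le_mul_left _ h2
    have h4 : D * (q / D) * q ≤ q * q := Nat.mul_le_mul_right _ h1
    nlinarith

/-- The number of elements of a quadratic extension of the field with `e ^ m` elements with
prescribed norm and prescribed trace of `a x + b / x` down to the field with `e` elements. -/
lemma card_norm_trace_fiber_le {F K : Type*} [Field F] [Fintype F] [Field K] [Fintype K]
    [Algebra F K] {m : ℕ} (hm : 4 ≤ m) (hfin : Module.finrank F K = 2 * m)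
    {a : F} (ha : a ≠ 0) (b u t : F) :
    Fintype.card F * (Fintype.card F - 1) * (Finset.univ.filter fun x : K => x ≠ 0 ∧
      Algebra.norm F x = u ∧
      Algebra.trace F K (algebraMap F K a * x + algebraMap F K b * x⁻¹) = t).card ≤
    Fintype.card F ^ m * Fintype.card F ^ m +
      10 * (Fintype.card F * (Fintype.card F - 1)) * Fintype.card F ^ m := by
  obtain ⟨p, hchar, ⟨f, hf⟩, hp, hpf⟩ := FiniteField.card' F
  have : Fact p.Prime := ⟨hp⟩
  have : CharP K p := charP_of_injective_algebraMap (algebraMap F K).injective p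
  simp only [PNat.mk_coe] at hpf
  have hcard : Fintype.card K = (p ^ f) ^ m * (p ^ f) ^ m := by
    rw [Module.card_eq_pow_finrank (K := F), hfin, hpf, two_mul, pow_add]
  have he : 2 ≤ p ^ f := hp.two_le.trans (Nat.le_self_pow hf.ne' p)
  rw [hpf]
  obtain ⟨A, L, hA, hAL, hD⟩ := stepanov_parameters he hm
  refine (Nat.mul_le_mul_left _ ?_).trans hD
  have hnat : Nat.card F = p ^ f := by rw [Nat.card_eq_fintype_card, hpf]
  refine card_fiber_le_of_lt p f m A L hf (by omega) hcard (algebraMap F K a) (algebraMap F K b)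
    (algebraMap F K u) (algebraMap F K t) (by simpa using ha) hA hAL _ ?_ ?_ ?_
  · intro x hx
    exact (Finset.mem_filter.1 hx).2.1
  · intro x hx
    rw [← (Finset.mem_filter.1 hx).2.2.1, FiniteField.algebraMap_norm_eq_pow_sum, hfin, hnat,
      two_mul, Finset.sum_range_add, pow_add, ← pow_mul, Finset.sum_mul]
    simp_rw [pow_add, mul_comm]
  · intro x hx
    rw [← (Finset.mem_filter.1 hx).2.2.2, FiniteField.algebraMap_trace_eq_sum_pow, hfin, hnat,
      two_mul, Finset.sum_range_add, ← pow_mul, sum_pow_char_pow]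
    congr 1
    refine Finset.sum_congr rfl fun i _ => ?_
    rw [← pow_mul _ ((p ^ f) ^ i), pow_mul p, pow_add, mul_comm ((p ^ f) ^ m)]

lemma MulChar.norm_apply_le {F : Type*} [Field F] [Fintype F] (χ : MulChar F ℂ) (u : F) :
    ‖χ u‖ ≤ 1 := by
  by_cases hu : u = 0
  · simp [hu]
  · refine le_of_eq ?_
    refine Complex.norm_eq_one_of_pow_eq_one (n := Fintype.card F - 1) ?_
      (by have := Fintype.one_lt_card (α := F); omega)
    rw [← map_pow, FiniteField.pow_card_sub_one_eq_one u hu, map_one]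

/-- The Kloosterman sum with coefficients `a, b ∈ F` over an extension `K` of `F`, twisted by
a multiplicative character of `F`. -/
def kloostermanSum {F : Type*} (K : Type*) [Field F] [Field K] [Fintype K] [Algebra F K]
    (χ : MulChar F ℂ) (ψ : AddChar F ℂ) (a b : F) : ℂ :=
  ∑ x : K, χ (Algebra.norm F x) *
    ψ (Algebra.trace F K (algebraMap F K a * x + algebraMap F K b * x⁻¹))

lemma norm_kloostermanSum_le_of_finrank_eq {F K : Type*} [Field F] [Fintype F] [Field K]
    [Fintype K] [Algebra F K] {m : ℕ} (hm : 4 ≤ m) (hfin : Module.finrank F K = 2 * m)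
    {a : F} (ha : a ≠ 0) (b : F) (χ : MulChar F ℂ) {ψ : AddChar F ℂ} (hψ : ψ ≠ 1) :
    ‖kloostermanSum K χ ψ a b‖ ≤
      11 * (Fintype.card F * (Fintype.card F - 1)) * (Fintype.card F : ℝ) ^ m := by
  set e := Fintype.card F with he
  have he2 : 1 < e := Fintype.one_lt_card
  set G : K → F × F := fun x => (Algebra.norm F x,
    Algebra.trace F K (algebraMap F K a * x + algebraMap F K b * x⁻¹)) with hG
  set Z : Finset K := Finset.univ.filter fun x => x ≠ 0 with hZ
  set N : F × F → ℕ := fun y => (Z.filter fun x => G x = y).card with hN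
  have hFK : FiniteDimensional F K := Module.finite_of_finrank_pos (by omega)
  have hsum : kloostermanSum K χ ψ a b = ∑ y : F × F, (N y : ℂ) * (χ y.1 * ψ y.2) := by
    have h1 : kloostermanSum K χ ψ a b = ∑ x ∈ Z, χ (G x).1 * ψ (G x).2 := by
      rw [kloostermanSum, hZ, Finset.sum_filter]
      refine Finset.sum_congr rfl fun x _ => ?_
      split_ifs with h
      · rfl
      · rw [not_not] at h
        simp [h, Algebra.norm_zero, MulChar.map_zero]
    rw [h1, ← Finset.sum_fiberwise Z G]
    refine Finset.sum_congr rfl fun y _ => ?_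
    rw [Finset.sum_congr rfl (g := fun _ => χ y.1 * ψ y.2), Finset.sum_const, nsmul_eq_mul]
    intro x hx
    rw [(Finset.mem_filter.1 hx).2]
  have hzero : ∑ y : F × F, χ y.1 * ψ y.2 = 0 := by
    rw [Fintype.sum_prod_type]
    simp_rw [← Finset.mul_sum]
    rw [AddChar.sum_eq_zero_of_ne_one hψ]
    simp
  set A : ℝ := (e : ℝ) ^ m * e ^ m / (e * (e - 1)) + 10 * e ^ m with hA
  have heR : (1 : ℝ) < e := by exact_mod_cast he2
  have hD : (0 : ℝ) < e * (e - 1) := mul_pos (by linarith) (by linarith)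
  have hNA : ∀ y, (N y : ℝ) ≤ A := by
    intro y
    have h := card_norm_trace_fiber_le (K := K) hm hfin ha b y.1 y.2
    have hcard : N y = (Finset.univ.filter fun x : K => x ≠ 0 ∧ Algebra.norm F x = y.1 ∧
      Algebra.trace F K (algebraMap F K a * x + algebraMap F K b * x⁻¹) = y.2).card := by
      rw [hN, hZ]
      simp only [Finset.filter_filter, hG, Prod.ext_iff]
    rw [← hcard, ← he] at h
    have h' : (e * (e - 1) : ℝ) * N y ≤ e ^ m * e ^ m + 10 * (e * (e - 1)) * e ^ m := by
      have := (Nat.cast_le (α := ℝ)).2 h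
      push_cast [Nat.cast_sub he2.le] at this
      exact this
    rw [hA, div_add' _ _ _ hD.ne', le_div_iff₀ hD]
    linarith
  set S : Finset (F × F) := Finset.univ.filter fun y => y.1 ≠ 0 with hS
  have hScard : (S.card : ℝ) = e * (e - 1) := by
    have : S = (Finset.univ.filter fun u : F => u ≠ 0) ×ˢ Finset.univ := by
      ext y; simp [hS]
    rw [this, Finset.card_product, Finset.filter_ne' , Finset.card_erase_of_mem (Finset.mem_univ _),
      Finset.card_univ, ← he]
    push_cast [Nat.cast_sub he2.le]
    ring
  have hNsum : ∑ y ∈ S, (N y : ℝ) = e ^ m * e ^ m - 1 := by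
    have h1 : Z.card = ∑ y ∈ S, N y := Finset.card_eq_sum_card_fiberwise (by
      intro x hx
      have hx' : x ≠ 0 := by simpa [hZ] using hx
      simpa [hS, hG, Algebra.norm_eq_zero_iff] using hx')
    have h2 : Z.card = e ^ m * e ^ m - 1 := by
      rw [hZ, Finset.filter_ne', Finset.card_erase_of_mem (Finset.mem_univ _), Finset.card_univ,
        Module.card_eq_pow_finrank (K := F), hfin, two_mul, pow_add]
    rw [← Nat.cast_sum, ← h1, h2, Nat.cast_sub (Nat.one_le_iff_ne_zero.2 (by positivity))]
    push_cast
    ring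
  have key : kloostermanSum K χ ψ a b = - ∑ y ∈ S, ((A - N y : ℝ) : ℂ) * (χ y.1 * ψ y.2) := by
    have h1 : ∑ y ∈ S, ((A - N y : ℝ) : ℂ) * (χ y.1 * ψ y.2) =
        ∑ y : F × F, ((A - N y : ℝ) : ℂ) * (χ y.1 * ψ y.2) := by
      refine Finset.sum_subset (Finset.subset_univ _) fun y _ hy => ?_
      have : y.1 = 0 := by simpa [hS] using hy
      simp [this, MulChar.map_zero]
    rw [h1, hsum]
    push_cast
    simp_rw [sub_mul]
    rw [Finset.sum_sub_distrib, ← Finset.mul_sum, hzero]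
    ring
  rw [key, norm_neg]
  have hpow : (1 : ℝ) ≤ e ^ m := one_le_pow₀ heR.le
  have hD1 : (1 : ℝ) ≤ e * (e - 1) := by
    have : (2 : ℝ) ≤ e := by exact_mod_cast he2
    nlinarith
  calc ‖∑ y ∈ S, ((A - N y : ℝ) : ℂ) * (χ y.1 * ψ y.2)‖
      ≤ ∑ y ∈ S, (A - N y) := by
        refine norm_sum_le_of_le _ fun y _ => ?_
        rw [norm_mul, norm_mul, AddChar.norm_apply, mul_one, Complex.norm_real,
          Real.norm_of_nonneg (sub_nonneg.2 (hNA y))]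
        exact mul_le_of_le_one_right (sub_nonneg.2 (hNA y)) (MulChar.norm_apply_le χ _)
    _ = 10 * (e * (e - 1)) * e ^ m + 1 := by
        rw [Finset.sum_sub_distrib, Finset.sum_const, nsmul_eq_mul, hScard, hNsum, hA, mul_add,
          mul_div_cancel₀ _ hD.ne']
        ring
    _ ≤ _ := by nlinarith

lemma adjoin_simple_inv {F K : Type*} [Field F] [Field K] [Algebra F K] (x : K) :
    IntermediateField.adjoin F {x⁻¹} = IntermediateField.adjoin F {x} := by
  refine le_antisymm ?_ ?_ <;> rw [IntermediateField.adjoin_simple_le_iff]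
  · exact inv_mem (IntermediateField.mem_adjoin_simple_self F x)
  · simpa using inv_mem (IntermediateField.mem_adjoin_simple_self F x⁻¹)

lemma nextCoeff_minpoly_inv {F K : Type*} [Field F] [Field K] [Algebra F K]
    [FiniteDimensional F K] {x : K} (hx : x ≠ 0) :
    (minpoly F x⁻¹).nextCoeff = (minpoly F x).coeff 1 / (minpoly F x).coeff 0 := by
  set P := minpoly F x with hP
  have hintegral : IsIntegral F x := .of_finite F x
  have h0 : P.coeff 0 ≠ 0 := minpoly.coeff_zero_ne_zero hintegral hx
  have htr : P.natTrailingDegree = 0 := by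
    rw [natTrailingDegree_eq_zero]; exact Or.inr h0
  have hrev : P.reverse.natDegree = P.natDegree := by rw [reverse_natDegree, htr, Nat.sub_zero]
  have hlead : P.reverse.leadingCoeff = P.coeff 0 := by
    rw [reverse_leadingCoeff, trailingCoeff, htr]
  have hmonic : (P.reverse * C (P.coeff 0)⁻¹).Monic := by
    rw [Monic, leadingCoeff_mul, hlead, leadingCoeff_C, mul_inv_cancel₀ h0]
  have hroot : aeval x⁻¹ (P.reverse * C (P.coeff 0)⁻¹) = 0 := by
    rw [map_mul]
    have : Invertible x := invertibleOfNonzero hx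
    have h := (eval₂_reverse_eq_zero_iff (algebraMap F K) x P).2 (minpoly.aeval F x)
    rw [invOf_eq_inv] at h
    rw [aeval_def, h, zero_mul]
  have hdeg : (minpoly F x⁻¹).natDegree = P.natDegree := by
    rw [← IntermediateField.adjoin.finrank (.of_finite F x⁻¹), adjoin_simple_inv,
      IntermediateField.adjoin.finrank hintegral]
  have heq : P.reverse * C (P.coeff 0)⁻¹ = minpoly F x⁻¹ := by
    refine eq_of_monic_of_dvd_of_natDegree_le (minpoly.monic (.of_finite F x⁻¹)) hmonic
      (minpoly.dvd F _ hroot) ?_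
    rw [hdeg, natDegree_mul_C (inv_ne_zero h0), hrev]
  rw [← heq, nextCoeff_mul_C, div_eq_mul_inv]
  congr 1
  have hrr : P.reverse.reverse = P := by
    ext i
    rw [coeff_reverse, coeff_reverse, hrev, revAt_invol]
  rw [← coeff_one_reverse, hrr]

/-- The completely multiplicative function on monic polynomials whose `L`-function has
the Kloosterman sums as power sums of its inverse roots. -/
def kloostermanWeight {F : Type*} [Field F] (χ : MulChar F ℂ) (ψ : AddChar F ℂ) (a b : F)
    (f : F[X]) : ℂ :=
  χ ((-1) ^ f.natDegree * f.coeff 0) * ψ (-(a * f.nextCoeff + b * (f.coeff 1 / f.coeff 0)))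

section KloostermanWeight

variable {F : Type*} [Field F] (χ : MulChar F ℂ) (ψ : AddChar F ℂ) (a b : F)

lemma kloostermanWeight_one : kloostermanWeight χ ψ a b 1 = 1 := by
  simp [kloostermanWeight, nextCoeff, coeff_one]

lemma kloostermanWeight_mul {f g : F[X]} (hf : f.Monic) (hg : g.Monic) :
    kloostermanWeight χ ψ a b (f * g) =
      kloostermanWeight χ ψ a b f * kloostermanWeight χ ψ a b g := by
  by_cases hf0 : f.coeff 0 = 0
  · simp [kloostermanWeight, mul_coeff_zero, hf0, MulChar.map_zero]
  by_cases hg0 : g.coeff 0 = 0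
  · simp [kloostermanWeight, mul_coeff_zero, hg0, MulChar.map_zero]
  have h1 : -(a * (f * g).nextCoeff + b * ((f * g).coeff 1 / (f * g).coeff 0)) =
      -(a * f.nextCoeff + b * (f.coeff 1 / f.coeff 0)) +
        -(a * g.nextCoeff + b * (g.coeff 1 / g.coeff 0)) := by
    rw [hf.nextCoeff_mul hg, mul_coeff_one, mul_coeff_zero]
    field_simp
    ring
  have h2 : (-1 : F) ^ (f * g).natDegree * (f * g).coeff 0 =
      ((-1) ^ f.natDegree * f.coeff 0) * ((-1) ^ g.natDegree * g.coeff 0) := by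
    rw [hf.natDegree_mul hg, mul_coeff_zero, pow_add]
    ring
  rw [kloostermanWeight, h1, h2, AddChar.map_add_eq_mul, map_mul]
  simp only [kloostermanWeight]
  ring

lemma kloostermanWeight_pow {f : F[X]} (hf : f.Monic) (i : ℕ) :
    kloostermanWeight χ ψ a b (f ^ i) = kloostermanWeight χ ψ a b f ^ i := by
  induction i with
  | zero => simp [kloostermanWeight_one]
  | succ i ih => rw [pow_succ, kloostermanWeight_mul χ ψ a b (hf.pow i) hf, ih, pow_succ]

end KloostermanWeight

/-- The characteristic polynomial of `x` over `F`, as a power of its minimal polynomial. -/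
def minpolyPow (F : Type*) {K : Type*} [Field F] [Field K] [Algebra F K] (x : K) : F[X] :=
  minpoly F x ^ Module.finrank (IntermediateField.adjoin F {x}) K

section MinpolyPow

variable {F K : Type*} [Field F] [Field K] [Algebra F K] [FiniteDimensional F K]

lemma monic_minpolyPow (x : K) : (minpolyPow F x).Monic :=
  (minpoly.monic (.of_finite F x)).pow _

lemma natDegree_minpoly_mul_finrank (x : K) : (minpoly F x).natDegree *
    Module.finrank (IntermediateField.adjoin F {x}) K = Module.finrank F K := by
  rw [← IntermediateField.adjoin.finrank (.of_finite F x), Module.finrank_mul_finrank]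

lemma natDegree_minpolyPow (x : K) : (minpolyPow F x).natDegree = Module.finrank F K := by
  rw [minpolyPow, natDegree_pow, mul_comm, natDegree_minpoly_mul_finrank]

lemma kloostermanWeight_minpolyPow (χ : MulChar F ℂ) (ψ : AddChar F ℂ) (a b : F) (x : K) :
    kloostermanWeight χ ψ a b (minpolyPow F x) = χ (Algebra.norm F x) *
      ψ (Algebra.trace F K (algebraMap F K a * x + algebraMap F K b * x⁻¹)) := by
  have hpos : Module.finrank (IntermediateField.adjoin F {x}) K ≠ 0 := by
    have := natDegree_minpoly_mul_finrank (F := F) x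
    have h2 : 0 < Module.finrank F K := Module.finrank_pos
    intro h
    rw [h] at this
    omega
  rw [minpolyPow, kloostermanWeight_pow χ ψ a b (minpoly.monic (.of_finite F x))]
  by_cases hx : x = 0
  · subst hx
    simp [kloostermanWeight, hpos, Algebra.norm_zero, MulChar.map_zero]
  have hnorm : Algebra.norm F x = ((-1) ^ (minpoly F x).natDegree * (minpoly F x).coeff 0) ^
      Module.finrank (IntermediateField.adjoin F {x}) K := by
    rw [Algebra.norm_eq_norm_adjoin]
    congr 1
    have h := Algebra.PowerBasis.norm_gen_eq_coeff_zero_minpoly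
      (IntermediateField.adjoin.powerBasis (K := F) (.of_finite F x))
    rw [IntermediateField.adjoin.powerBasis_gen, IntermediateField.adjoin.powerBasis_dim,
      IntermediateField.minpoly_gen] at h
    exact h
  have htrace : Algebra.trace F K (algebraMap F K a * x + algebraMap F K b * x⁻¹) =
      Module.finrank (IntermediateField.adjoin F {x}) K •
        -(a * (minpoly F x).nextCoeff +
          b * ((minpoly F x).coeff 1 / (minpoly F x).coeff 0)) := by
    rw [map_add, ← Algebra.smul_def, ← Algebra.smul_def, map_smul, map_smul,
      trace_eq_finrank_mul_minpoly_nextCoeff F x, trace_eq_finrank_mul_minpoly_nextCoeff F x⁻¹,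
      nextCoeff_minpoly_inv hx, adjoin_simple_inv, nsmul_eq_mul, smul_eq_mul, smul_eq_mul]
    ring
  rw [hnorm, htrace, AddChar.map_nsmul_eq_pow, map_pow, kloostermanWeight, mul_pow]

end MinpolyPow

lemma card_minpoly_eq {F K : Type*} [Field F] [Fintype F] [Field K] [Fintype K] [Algebra F K]
    {P : F[X]} (hP : Irreducible P) (hm : P.Monic) (hd : P.natDegree ∣ Module.finrank F K) :
    (Finset.univ.filter fun x : K => minpoly F x = P).card = P.natDegree := by
  have hdvd := (hP.natDegree_dvd_iff_dvd_X_pow_card_pow_sub_X).1 hd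
  have hKcard : Nat.card F ^ Module.finrank F K = Fintype.card K := by
    rw [Nat.card_eq_fintype_card, ← Module.card_eq_pow_finrank]
  rw [hKcard] at hdvd
  have hsplit : (P.map (algebraMap F K)).Splits := by
    refine Splits.of_dvd (FiniteField.isSplittingField_sub K F).splits ?_
      (Polynomial.map_dvd (algebraMap F K) hdvd)
    exact Polynomial.map_ne_zero (FiniteField.X_pow_card_sub_X_ne_zero F Fintype.one_lt_card)
  rw [← card_rootSet_eq_natDegree (PerfectField.separable_of_irreducible hP) hsplit,
    Fintype.card_subtype]
  congr 1
  ext x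
  simp only [Finset.mem_filter, Finset.mem_univ, true_and, mem_rootSet, and_iff_right hP.ne_zero,
    ne_eq]
  exact ⟨fun h => h ▸ minpoly.aeval F x,
    fun h => (minpoly.eq_of_irreducible_of_monic hP h hm).symm⟩

lemma Polynomial.Monic.prod_normalizedFactors_eq_self {F : Type*} [Field F] {f : F[X]}
    (hf : f.Monic) : (normalizedFactors f).prod = f := by
  have h := leadingCoeff_mul_prod_normalizedFactors f
  rwa [hf.leadingCoeff, map_one, one_mul] at h

lemma Polynomial.Monic.sum_count_mul_natDegree {F : Type*} [Field F] {f : F[X]} (hf : f.Monic) :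
    ∑ P ∈ (normalizedFactors f).toFinset, (normalizedFactors f).count P * P.natDegree =
      f.natDegree := by
  conv_rhs => rw [← hf.prod_normalizedFactors_eq_self]
  rw [natDegree_multiset_prod _ (zero_notMem_normalizedFactors f),
    Finset.sum_multiset_map_count]
  simp

lemma pow_dvd_iff_le_count_normalizedFactors {F : Type*} [Field F] {f P : F[X]} (hf : f ≠ 0)
    (hP : Irreducible P) (hm : P.Monic) (i : ℕ) :
    P ^ i ∣ f ↔ i ≤ (normalizedFactors f).count P := by
  rw [dvd_iff_normalizedFactors_le_normalizedFactors (pow_ne_zero _ hP.ne_zero) hf,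
    normalizedFactors_pow, normalizedFactors_irreducible hP, hm.normalize_eq_self,
    Multiset.nsmul_singleton, Multiset.le_count_iff_replicate_le]

lemma card_filter_dvd_succ_and_div_le {n d c : ℕ} (hd : 0 < d) (h : c * d ≤ n) :
    ((Finset.range n).filter fun j => d ∣ j + 1 ∧ (j + 1) / d ≤ c).card = c := by
  conv_rhs => rw [← Finset.card_range c]
  symm
  refine Finset.card_nbij (fun i => d * (i + 1) - 1) ?_ ?_ ?_
  · intro i hi
    have hi : i < c := by simpa using hi
    have h1 : d * (i + 1) ≤ c * d := by rw [mul_comm c]; exact Nat.mul_le_mul_left _ hi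
    have h2 : 0 < d * (i + 1) := by positivity
    have h3 : d * (i + 1) - 1 + 1 = d * (i + 1) := by omega
    simp only [Finset.coe_filter, Finset.mem_range, Set.mem_ofPred_eq, h3,
      Nat.mul_div_cancel_left _ hd]
    exact ⟨by omega, dvd_mul_right _ _, hi⟩
  · intro i _ i' _ hii
    have h1 : 0 < d * (i + 1) := by positivity
    have h2 : 0 < d * (i' + 1) := by positivity
    have h3 : d * (i + 1) = d * (i' + 1) := by simp only at hii; omega
    have := Nat.eq_of_mul_eq_mul_left hd h3
    omega
  · intro j hj
    simp only [Finset.coe_filter, Finset.mem_range, Set.mem_ofPred_eq] at hj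
    obtain ⟨_, ⟨i, hi⟩, h3⟩ := hj
    rw [hi, Nat.mul_div_cancel_left _ hd] at h3
    have hi0 : i ≠ 0 := by rintro rfl; simp at hi
    refine ⟨i - 1, by simp; omega, ?_⟩
    simp only
    rw [Nat.sub_add_cancel (Nat.one_le_iff_ne_zero.2 hi0), ← hi, Nat.add_sub_cancel]

lemma card_minpolyPow_dvd {F K : Type*} [Field F] [Fintype F] [Field K] [Fintype K]
    [Algebra F K] {f : F[X]} (hf : f.Monic) :
    (Finset.univ.filter fun x : K => minpolyPow F x ∣ f).card =
      ∑ P ∈ (normalizedFactors f).toFinset,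
        if P.natDegree ∣ Module.finrank F K ∧
          Module.finrank F K / P.natDegree ≤ (normalizedFactors f).count P
        then P.natDegree else 0 := by
  have hfinrank : ∀ x : K, Module.finrank (IntermediateField.adjoin F {x}) K ≠ 0 := by
    intro x h
    have h1 := natDegree_minpoly_mul_finrank (F := F) x
    have h2 : 0 < Module.finrank F K := Module.finrank_pos
    rw [h] at h1
    omega
  rw [Finset.card_eq_sum_card_fiberwise (f := fun x => minpoly F x)
    (t := (normalizedFactors f).toFinset)]
  · refine Finset.sum_congr rfl fun P hP => ?_
    rw [Multiset.mem_toFinset, Polynomial.mem_normalizedFactors_iff hf.ne_zero] at hP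
    obtain ⟨hPi, hPm, -⟩ := hP
    have key : ∀ x : K, minpoly F x = P →
        (minpolyPow F x ∣ f ↔ P.natDegree ∣ Module.finrank F K ∧
          Module.finrank F K / P.natDegree ≤ (normalizedFactors f).count P) := by
      intro x hx
      have h := natDegree_minpoly_mul_finrank (F := F) x
      rw [hx] at h
      rw [minpolyPow, hx, pow_dvd_iff_le_count_normalizedFactors hf.ne_zero hPi hPm, ← h,
        Nat.mul_div_cancel_left _ hPi.natDegree_pos]
      simp
    rw [Finset.filter_filter]
    split_ifs with hc
    · rw [← card_minpoly_eq (K := K) hPi hPm hc.1]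
      congr 1
      ext x
      simp only [Finset.mem_filter, Finset.mem_univ, true_and, and_iff_right_iff_imp]
      exact fun hx => (key x hx).2 hc
    · rw [Finset.card_eq_zero, Finset.filter_eq_empty_iff]
      rintro x - ⟨h1, h2⟩
      exact hc ((key x h2).1 h1)
  · intro x hx
    have hx : minpolyPow F x ∣ f := by simpa using hx
    rw [Finset.mem_coe, Multiset.mem_toFinset, Polynomial.mem_normalizedFactors_iff hf.ne_zero]
    exact ⟨minpoly.irreducible (.of_finite F x), minpoly.monic (.of_finite F x),
      (dvd_pow_self _ (hfinrank x)).trans hx⟩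

lemma sum_card_minpolyPow_dvd {F : Type*} [Field F] [Fintype F] (K : ℕ → Type*)
    [∀ j, Field (K j)] [∀ j, Fintype (K j)] [∀ j, Algebra F (K j)]
    (hK : ∀ j, Module.finrank F (K j) = j + 1) {f : F[X]} (hf : f.Monic) :
    ∑ j ∈ Finset.range f.natDegree,
      (Finset.univ.filter fun x : K j => minpolyPow F x ∣ f).card = f.natDegree := by
  simp_rw [card_minpolyPow_dvd hf, hK]
  rw [Finset.sum_comm]
  conv_rhs => rw [← hf.sum_count_mul_natDegree]
  refine Finset.sum_congr rfl fun P hP => ?_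
  have hP' := hP
  rw [Multiset.mem_toFinset, Polynomial.mem_normalizedFactors_iff hf.ne_zero] at hP'
  rw [← Finset.sum_filter, Finset.sum_const, smul_eq_mul,
    card_filter_dvd_succ_and_div_le hP'.1.natDegree_pos]
  conv_rhs => rw [← hf.sum_count_mul_natDegree]
  exact Finset.single_le_sum (f := fun P => (normalizedFactors f).count P * P.natDegree)
    (fun _ _ => Nat.zero_le _) hP

/-- The monic polynomials of degree `d` over a finite field. -/
def monicsOfDegree (F : Type*) [Field F] [Fintype F] (d : ℕ) : Finset F[X] :=
  Finset.univ.image fun v : Fin d → F => X ^ d + ∑ i, C (v i) * X ^ (i : ℕ)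

lemma degree_sum_fin_C_mul_X_pow_lt {F : Type*} [Field F] {d : ℕ} (v : Fin d → F) :
    (∑ i, C (v i) * X ^ (i : ℕ)).degree < (d : WithBot ℕ) := by
  refine (degree_sum_le _ _).trans_lt ?_
  rw [Finset.sup_lt_iff (by exact WithBot.bot_lt_coe d)]
  intro i _
  exact (degree_C_mul_X_pow_le _ _).trans_lt (by exact_mod_cast i.2)

lemma injective_X_pow_add_sum {F : Type*} [Field F] (d : ℕ) :
    Function.Injective fun v : Fin d → F => X ^ d + ∑ i, C (v i) * X ^ (i : ℕ) := by
  intro v w h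
  have h := add_left_cancel h
  ext i
  have hc := congrArg (fun p : F[X] => p.coeff i) h
  simpa [finsetSum_coeff, coeff_C_mul, coeff_X_pow, Fin.val_inj] using hc

lemma mem_monicsOfDegree {F : Type*} [Field F] [Fintype F] {d : ℕ} {f : F[X]} :
    f ∈ monicsOfDegree F d ↔ f.Monic ∧ f.natDegree = d := by
  constructor
  · intro h
    obtain ⟨v, -, rfl⟩ := Finset.mem_image.1 h
    have hv := degree_sum_fin_C_mul_X_pow_lt v
    refine ⟨monic_X_pow_add hv, natDegree_eq_of_degree_eq_some ?_⟩
    rw [degree_add_eq_left_of_degree_lt (by rwa [degree_X_pow]), degree_X_pow]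
  · rintro ⟨hf, rfl⟩
    refine Finset.mem_image.2 ⟨fun i => f.coeff i, Finset.mem_univ _, ?_⟩
    conv_rhs => rw [hf.as_sum]
    rw [Fin.sum_univ_eq_sum_range (fun i => C (f.coeff i) * X ^ i)]

lemma sum_monicsOfDegree_filter_dvd {F : Type*} [Field F] [Fintype F] (χ : MulChar F ℂ)
    (ψ : AddChar F ℂ) (a b : F) {n : ℕ} {p : F[X]} (hp : p.Monic) (hn : p.natDegree ≤ n) :
    ∑ f ∈ (monicsOfDegree F n).filter (p ∣ ·), kloostermanWeight χ ψ a b f =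
      kloostermanWeight χ ψ a b p *
        ∑ f ∈ monicsOfDegree F (n - p.natDegree), kloostermanWeight χ ψ a b f := by
  rw [Finset.mul_sum]
  symm
  refine Finset.sum_nbij (fun h => p * h) ?_ ?_ ?_ ?_
  · intro h hh
    rw [mem_monicsOfDegree] at hh
    rw [Finset.mem_filter, mem_monicsOfDegree, hp.natDegree_mul hh.1, hh.2]
    exact ⟨⟨hp.mul hh.1, by omega⟩, dvd_mul_right _ _⟩
  · intro h _ h' _ hhh
    exact mul_left_cancel₀ hp.ne_zero hhh
  · intro f hf
    rw [Finset.mem_coe, Finset.mem_filter, mem_monicsOfDegree] at hf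
    obtain ⟨⟨hfm, hfd⟩, h, rfl⟩ := hf
    have hh : h.Monic := hp.of_mul_monic_left hfm
    refine ⟨h, ?_, rfl⟩
    rw [Finset.mem_coe, mem_monicsOfDegree]
    rw [hp.natDegree_mul hh] at hfd
    exact ⟨hh, by omega⟩
  · intro h hh
    rw [mem_monicsOfDegree] at hh
    rw [kloostermanWeight_mul χ ψ a b hp hh.1]

/-- Newton's identity relating the coefficients of the `L`-function to Kloosterman sums. -/
lemma mul_sum_kloostermanWeight {F : Type*} [Field F] [Fintype F] (K : ℕ → Type*)
    [∀ j, Field (K j)] [∀ j, Fintype (K j)] [∀ j, Algebra F (K j)]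
    (hK : ∀ j, Module.finrank F (K j) = j + 1) (χ : MulChar F ℂ) (ψ : AddChar F ℂ) (a b : F)
    (n : ℕ) :
    n * ∑ f ∈ monicsOfDegree F n, kloostermanWeight χ ψ a b f =
      ∑ j ∈ Finset.range n, kloostermanSum (K j) χ ψ a b *
        ∑ f ∈ monicsOfDegree F (n - (j + 1)), kloostermanWeight χ ψ a b f := by
  have h1 : ∀ f ∈ monicsOfDegree F n, n * kloostermanWeight χ ψ a b f =
      ∑ j ∈ Finset.range n, ∑ x : K j,
        if minpolyPow F x ∣ f then kloostermanWeight χ ψ a b f else 0 := by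
    intro f hf
    rw [mem_monicsOfDegree] at hf
    have h := sum_card_minpolyPow_dvd K hK hf.1
    rw [hf.2] at h
    conv_lhs => rw [← h]
    rw [Nat.cast_sum, Finset.sum_mul]
    refine Finset.sum_congr rfl fun j _ => ?_
    rw [← Finset.sum_filter, Finset.sum_const, nsmul_eq_mul]
  rw [Finset.mul_sum, Finset.sum_congr rfl h1, Finset.sum_comm]
  refine Finset.sum_congr rfl fun j hj => ?_
  rw [Finset.sum_comm, kloostermanSum, Finset.sum_mul]
  refine Finset.sum_congr rfl fun x _ => ?_
  have hdeg : (minpolyPow F x).natDegree = j + 1 := by rw [natDegree_minpolyPow, hK]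
  rw [← Finset.sum_filter, sum_monicsOfDegree_filter_dvd χ ψ a b (monic_minpolyPow x)
    (by rw [hdeg]; exact Finset.mem_range.1 hj), kloostermanWeight_minpolyPow, hdeg]

lemma exists_apply_neg_mul_ne_one {F : Type*} [Field F] {ψ : AddChar F ℂ} {a : F}
    (hψ : ψ ≠ 1) (ha : a ≠ 0) : ∃ s : F, ψ (-(a * s)) ≠ 1 := by
  obtain ⟨t, ht⟩ := AddChar.ne_one_iff.1 hψ
  refine ⟨-(a⁻¹ * t), ?_⟩
  rwa [mul_neg, neg_neg, mul_inv_cancel_left₀ ha]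

section KloostermanLFunction

variable {F : Type*} [Field F] [Fintype F] (χ : MulChar F ℂ) {ψ : AddChar F ℂ} {a : F} (b : F)

lemma sum_kloostermanWeight_degree_zero (ψ : AddChar F ℂ) (a : F) :
    ∑ f ∈ monicsOfDegree F 0, kloostermanWeight χ ψ a b f = 1 := by
  have : monicsOfDegree F 0 = {1} := by
    ext f
    rw [mem_monicsOfDegree, Finset.mem_singleton]
    constructor
    · rintro ⟨h1, h2⟩
      exact h1.natDegree_eq_zero.1 h2
    · rintro rfl
      exact ⟨monic_one, natDegree_one⟩
  rw [this, Finset.sum_singleton, kloostermanWeight_one]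

lemma sum_kloostermanWeight_eq_zero (hψ : ψ ≠ 1) (ha : a ≠ 0) {d : ℕ} (hd : 3 ≤ d) :
    ∑ f ∈ monicsOfDegree F d, kloostermanWeight χ ψ a b f = 0 := by
  obtain ⟨s, hs⟩ := exists_apply_neg_mul_ne_one hψ ha
  have hdeg : ∀ (t : F) {f : F[X]}, f.Monic → f.natDegree = d →
      (C t * X ^ (d - 1)).degree < f.degree := by
    intro t f hf hfd
    rw [degree_eq_natDegree hf.ne_zero, hfd]
    exact (degree_C_mul_X_pow_le _ _).trans_lt (by exact_mod_cast (by omega : d - 1 < d))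
  have hmem : ∀ (t : F) {f : F[X]}, f ∈ monicsOfDegree F d →
      f + C t * X ^ (d - 1) ∈ monicsOfDegree F d := by
    intro t f hf
    rw [mem_monicsOfDegree] at hf ⊢
    refine ⟨hf.1.add_of_left (hdeg t hf.1 hf.2), ?_⟩
    rw [natDegree_eq_of_degree_eq (degree_add_eq_left_of_degree_lt (hdeg t hf.1 hf.2)), hf.2]
  have hshift : ∑ f ∈ monicsOfDegree F d, kloostermanWeight χ ψ a b f =
      ∑ f ∈ monicsOfDegree F d, kloostermanWeight χ ψ a b f * ψ (-(a * s)) := by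
    symm
    refine Finset.sum_nbij' (fun f => f + C s * X ^ (d - 1)) (fun f => f + C (-s) * X ^ (d - 1))
      (fun f hf => hmem s hf) (fun f hf => hmem (-s) hf) ?_ ?_ ?_
    · intro f _
      simp
    · intro f _
      simp
    · intro f hf
      have h2 := mem_monicsOfDegree.1 (hmem s hf)
      have h1 := mem_monicsOfDegree.1 hf
      have hnc : (f + C s * X ^ (d - 1)).nextCoeff = f.nextCoeff + s := by
        rw [nextCoeff_of_natDegree_pos (by omega), nextCoeff_of_natDegree_pos (by omega), h1.2,
          h2.2]
        simp
      have hc0 : (f + C s * X ^ (d - 1)).coeff 0 = f.coeff 0 := by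
        rw [coeff_add, coeff_C_mul_X_pow, if_neg (by omega), add_zero]
      have hc1 : (f + C s * X ^ (d - 1)).coeff 1 = f.coeff 1 := by
        rw [coeff_add, coeff_C_mul_X_pow, if_neg (by omega), add_zero]
      rw [kloostermanWeight, kloostermanWeight, hnc, hc0, hc1, h1.2, h2.2, mul_assoc,
        ← AddChar.map_add_eq_mul]
      congr 2
      ring
  rw [← Finset.sum_mul] at hshift
  have h : (∑ f ∈ monicsOfDegree F d, kloostermanWeight χ ψ a b f) * (1 - ψ (-(a * s))) = 0 := by
    rw [mul_sub, mul_one, ← hshift, sub_self]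
  exact (mul_eq_zero.1 h).resolve_right (sub_ne_zero.2 hs.symm)

lemma norm_sum_kloostermanWeight_degree_two_le (hψ : ψ ≠ 1) (ha : a ≠ 0) :
    ‖∑ f ∈ monicsOfDegree F 2, kloostermanWeight χ ψ a b f‖ ≤ Fintype.card F := by
  have h1 : ∑ f ∈ monicsOfDegree F 2, kloostermanWeight χ ψ a b f =
      ∑ v : F, ∑ u : F, χ v * ψ (-((a + b / v) * u)) := by
    rw [monicsOfDegree, Finset.sum_image (injective_X_pow_add_sum 2).injOn,
      ← Fintype.sum_prod_type', ← (finTwoArrowEquiv F).symm.sum_comp]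
    refine Finset.sum_congr rfl fun y _ => ?_
    have hf : X ^ 2 + ∑ i, C ((finTwoArrowEquiv F).symm y i) * X ^ (i : ℕ) =
        X ^ 2 + C y.2 * X + C y.1 := by
      simp [Fin.sum_univ_two, finTwoArrowEquiv]
      ring
    have hd : (X ^ 2 + C y.2 * X + C y.1).natDegree = 2 := by compute_degree!
    rw [hf, kloostermanWeight, nextCoeff_of_natDegree_pos (by omega), hd]
    simp [coeff_X, coeff_C]
    left
    congr 1
    ring
  have h2 : ∀ v : F, v ≠ -b / a → ∑ u : F, χ v * ψ (-((a + b / v) * u)) = 0 := by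
    intro v hv
    by_cases hv0 : v = 0
    · simp [hv0, MulChar.map_zero]
    rw [← Finset.mul_sum]
    have hne : a + b / v ≠ 0 := by
      intro h
      apply hv
      field_simp at h ⊢
      linear_combination h
    have h3 : ∑ u : F, ψ (-((a + b / v) * u)) = ∑ u : F, ψ u := by
      refine Fintype.sum_bijective (fun u => -((a + b / v) * u)) ?_ _ _ fun _ => rfl
      exact (Equiv.neg F).bijective.comp (mulLeft_bijective₀ _ hne)
    rw [h3, AddChar.sum_eq_zero_of_ne_one hψ, mul_zero]
  rw [h1, Finset.sum_eq_single (-b / a) (fun v _ hv => h2 v hv) (by simp)]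
  refine (norm_sum_le_of_le _ (fun u _ => ?_ : ∀ u ∈ Finset.univ, _ ≤ (1 : ℝ))).trans (by simp)
  rw [norm_mul, AddChar.norm_apply, mul_one]
  exact MulChar.norm_apply_le χ _

end KloostermanLFunction

lemma norm_le_of_norm_pow_add_pow_le {z w : ℂ} {e C : ℝ} (he : 0 < e) (hzw : ‖z‖ * ‖w‖ ≤ e ^ 2)
    (h : ∀ m : ℕ, 4 ≤ m → ‖z ^ m + w ^ m‖ ≤ C * e ^ m) : ‖z‖ ≤ e := by
  by_contra! hz
  have hw : ‖w‖ ≤ e := by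
    by_contra! hw
    nlinarith
  have hb : ∀ m : ℕ, 4 ≤ m → (‖z‖ / e) ^ m ≤ C + 1 := by
    intro m hm
    rw [div_pow, div_le_iff₀ (by positivity), ← norm_pow]
    calc ‖z ^ m‖ = ‖(z ^ m + w ^ m) - w ^ m‖ := by ring_nf
      _ ≤ ‖z ^ m + w ^ m‖ + ‖w ^ m‖ := norm_sub_le _ _
      _ ≤ C * e ^ m + e ^ m := by
        gcongr
        · exact h m hm
        · rw [norm_pow]; gcongr
      _ = _ := by ring
  have hgt : 1 < ‖z‖ / e := by rwa [one_lt_div he]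
  obtain ⟨N, hN⟩ := pow_unbounded_of_one_lt (C + 1) hgt
  have h1 := hb (N + 4) (by omega)
  have h2 : (‖z‖ / e) ^ N ≤ (‖z‖ / e) ^ (N + 4) := pow_le_pow_right₀ hgt.le (by omega)
  linarith

lemma norm_le_two_mul_sqrt_of_newton {K c : ℕ → ℂ} {e C : ℝ} (he : 0 < e) (hc0 : c 0 = 1)
    (hc2 : ‖c 2‖ ≤ e) (hc3 : ∀ d, 3 ≤ d → c d = 0)
    (hnewton : ∀ n : ℕ, n * c n = ∑ j ∈ Finset.range n, K j * c (n - (j + 1)))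
    (hbound : ∀ m : ℕ, 4 ≤ m → ‖K (2 * m - 1)‖ ≤ C * e ^ m) : ‖K 0‖ ≤ 2 * √e := by
  obtain ⟨s, hs⟩ := IsAlgClosed.exists_pow_nat_eq (c 1 ^ 2 - 4 * c 2) (n := 2) (by norm_num)
  obtain ⟨x, y, hsum, hprod⟩ : ∃ x y : ℂ, x + y = -c 1 ∧ x * y = c 2 :=
    ⟨(-c 1 + s) / 2, (-c 1 - s) / 2, by ring, by linear_combination (-1 / 4 : ℂ) * hs⟩
  have hK0 : K 0 = -(x + y) := by
    have h := hnewton 1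
    simp [hc0] at h
    rw [← h, hsum, neg_neg]
  have hK1 : K 1 = -(x ^ 2 + y ^ 2) := by
    have h := hnewton 2
    simp [Finset.sum_range_succ, hc0] at h
    linear_combination -h + 2 * hprod + (-c 1) * hK0 + (x + y) * hsum - 4 * hprod
  have hrec : ∀ n, K (n + 2) = -(K (n + 1) * c 1 + K n * c 2) := by
    intro n
    have h := hnewton (n + 3)
    rw [hc3 (n + 3) (by omega), mul_zero, Finset.sum_range_succ, Finset.sum_range_succ,
      Finset.sum_range_succ, Finset.sum_eq_zero] at h
    · rw [show n + 3 - (n + 1) = 2 by omega, show n + 3 - (n + 1 + 1) = 1 by omega,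
        show n + 3 - (n + 2 + 1) = 0 by omega, hc0] at h
      linear_combination -h
    · intro j hj
      rw [hc3 _ (by have := Finset.mem_range.1 hj; omega), mul_zero]
  have hK : ∀ n, K n = -(x ^ (n + 1) + y ^ (n + 1)) ∧
      K (n + 1) = -(x ^ (n + 2) + y ^ (n + 2)) := by
    intro n
    induction n with
    | zero => exact ⟨by simpa using hK0, by simpa using hK1⟩
    | succ n ih =>
      refine ⟨ih.2, ?_⟩
      have hc1 : c 1 = -(x + y) := by rw [hsum, neg_neg]
      rw [hrec, ih.1, ih.2, ← hprod, hc1]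
      ring
  have hpow : ∀ m : ℕ, 4 ≤ m → ‖(x ^ 2) ^ m + (y ^ 2) ^ m‖ ≤ C * e ^ m := by
    intro m hm
    have h := hbound m hm
    rw [(hK _).1, norm_neg, show 2 * m - 1 + 1 = 2 * m by omega, pow_mul, pow_mul] at h
    exact h
  have hxy : ‖x ^ 2‖ * ‖y ^ 2‖ ≤ e ^ 2 := by
    rw [← norm_mul, ← mul_pow, hprod, norm_pow]
    gcongr
  have hx : ‖x‖ ≤ √e := by
    refine Real.le_sqrt_of_sq_le ?_
    rw [← norm_pow]
    exact norm_le_of_norm_pow_add_pow_le he hxy hpow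
  have hy : ‖y‖ ≤ √e := by
    refine Real.le_sqrt_of_sq_le ?_
    rw [← norm_pow]
    refine norm_le_of_norm_pow_add_pow_le (C := C) he (by rwa [mul_comm]) fun m hm => ?_
    rw [add_comm]
    exact hpow m hm
  rw [hK0, norm_neg]
  linarith [norm_add_le x y]

/-- Weil's bound for twisted Kloosterman sums. -/
theorem norm_sum_mulChar_mul_addChar_le {F : Type*} [Field F] [Fintype F] (χ : MulChar F ℂ)
    {ψ : AddChar F ℂ} (hψ : ψ ≠ 1) {a : F} (ha : a ≠ 0) (b : F) :
    ‖∑ x : F, χ x * ψ (a * x + b * x⁻¹)‖ ≤ 2 * √(Fintype.card F) := by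
  obtain ⟨p, hchar, -, hp, -⟩ := FiniteField.card' F
  have : Fact p.Prime := ⟨hp⟩
  let K : ℕ → Type := fun j => FiniteField.Extension F p (j + 1)
  let _ : ∀ j, Field (K j) := fun j => inferInstanceAs (Field (FiniteField.Extension F p (j + 1)))
  let _ : ∀ j, Algebra F (K j) := fun j =>
    inferInstanceAs (Algebra F (FiniteField.Extension F p (j + 1)))
  let _ : ∀ j, Fintype (K j) := fun j => Fintype.ofFinite (FiniteField.Extension F p (j + 1))
  have hK : ∀ j, Module.finrank F (K j) = j + 1 := fun j =>
    FiniteField.finrank_extension F p (j + 1)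
  have hnewton := mul_sum_kloostermanWeight K hK χ ψ a b
  have he : (0 : ℝ) < Fintype.card F := by exact_mod_cast Fintype.card_pos
  have h0 : kloostermanSum (K 0) χ ψ a b = ∑ x : F, χ x * ψ (a * x + b * x⁻¹) := by
    have hbij : Function.Bijective (algebraMap F (K 0)) := by
      have : Module.finrank F (K 0) = 1 := hK 0
      exact Algebra.finrank_eq_one_iff_bijective_algebraMap.1 this
    rw [kloostermanSum]
    symm
    refine Fintype.sum_bijective (algebraMap F (K 0)) hbij _ _ fun x => ?_
    rw [Algebra.norm_algebraMap, hK 0, ← map_inv₀, ← map_mul, ← map_mul, ← map_add,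
      Algebra.trace_algebraMap, hK 0]
    simp
  rw [← h0]
  have hbound : ∀ m : ℕ, 4 ≤ m → ‖kloostermanSum (K (2 * m - 1)) χ ψ a b‖ ≤
      11 * (Fintype.card F * (Fintype.card F - 1)) * (Fintype.card F : ℝ) ^ m := fun m hm =>
    norm_kloostermanSum_le_of_finrank_eq hm (by rw [hK]; omega) ha b χ hψ
  exact norm_le_two_mul_sqrt_of_newton (K := fun j => kloostermanSum (K j) χ ψ a b) he
    (sum_kloostermanWeight_degree_zero χ b ψ a)
    (norm_sum_kloostermanWeight_degree_two_le χ b hψ ha)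
    (fun d hd => sum_kloostermanWeight_eq_zero χ b hψ ha hd) hnewton hbound

/-- Every additive character of a finite field is a multiplicative shift of a fixed nontrivial
one. -/
lemma AddChar.exists_mulShift_eq {F : Type*} [Field F] [Fintype F] {ψ : AddChar F ℂ}
    (hψ : ψ ≠ 1) (φ : AddChar F ℂ) : ∃ a : F, φ = ψ.mulShift a := by
  have hbij : Function.Bijective ψ.mulShift := by
    rw [Fintype.bijective_iff_injective_and_card]
    exact ⟨AddChar.to_mulShift_inj_of_isPrimitive (AddChar.IsPrimitive.of_ne_one hψ),
      AddChar.card_eq.symm⟩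
  obtain ⟨a, ha⟩ := hbij.2 φ
  exact ⟨a, ha.symm⟩

lemma AddChar.exists_ne_one_of_finite_field (F : Type*) [Field F] [Fintype F] :
    ∃ ψ : AddChar F ℂ, ψ ≠ 1 := by
  have : Nontrivial (AddChar F ℂ) := by
    rw [← Fintype.one_lt_card_iff_nontrivial, AddChar.card_eq]
    exact Fintype.one_lt_card
  exact exists_ne 1

lemma sum_units_eq_sum_mulChar {F : Type*} [Field F] [Fintype F] (χ : MulChar F ℂ)
    (f : F → ℂ) : ∑ u : Fˣ, f u * χ u = ∑ x : F, χ x * f x := by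
  rw [← Fintype.sum_subtype_add_sum_subtype (fun x : F => x ≠ 0)]
  have h0 : ∑ x : {x : F // ¬ x ≠ 0}, χ x * f x = 0 := by
    refine Finset.sum_eq_zero fun x _ => ?_
    have hx : (x : F) = 0 := not_not.1 x.2
    rw [hx, MulChar.map_zero, zero_mul]
  rw [h0, add_zero]
  refine Fintype.sum_equiv unitsEquivNeZero _ _ fun u => ?_
  simp [mul_comm]

lemma norm_sum_units_sub_le {F : Type*} [Field F] [Fintype F] (ψ₁ ψ₂ : AddChar F ℂ)
    (θ : AddChar (Additive Fˣ) ℂ) :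
    ‖∑ u : Fˣ, ψ₁ u * ψ₂ (u⁻¹ : F) * θ (Additive.ofMul u) -
      (if ψ₁ = 0 ∧ ψ₂ = 0 ∧ θ = 0 then (Fintype.card F : ℂ) else 0)‖ ≤
        2 * √(Fintype.card F) := by
  have hcard : (1 : ℝ) ≤ √(Fintype.card F) := by
    rw [Real.one_le_sqrt]
    exact_mod_cast Fintype.card_pos (α := F)
  let f : Fˣ →* ℂ :=
    { toFun := fun u => θ (Additive.ofMul u)
      map_one' := by simp
      map_mul' := fun u v => by rw [ofMul_mul, AddChar.map_add_eq_mul] }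
  set χ : MulChar F ℂ := MulChar.ofUnitHom f.toHomUnits with hχ
  have hχθ : ∀ u : Fˣ, χ u = θ (Additive.ofMul u) := fun u => by
    rw [hχ, MulChar.ofUnitHom_coe]; rfl
  obtain ⟨ψ, hψ⟩ := AddChar.exists_ne_one_of_finite_field F
  obtain ⟨a, rfl⟩ := AddChar.exists_mulShift_eq hψ ψ₁
  obtain ⟨b, rfl⟩ := AddChar.exists_mulShift_eq hψ ψ₂
  have hzero : ∀ c : F, c ≠ 0 → ψ.mulShift c ≠ 0 := fun c hc =>
    AddChar.IsPrimitive.of_ne_one hψ hc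
  have hsum : ∑ u : Fˣ, ψ.mulShift a u * ψ.mulShift b (u⁻¹ : F) * θ (Additive.ofMul u) =
      ∑ x : F, χ x * ψ (a * x + b * x⁻¹) := by
    rw [← sum_units_eq_sum_mulChar χ fun x => ψ (a * x + b * x⁻¹)]
    refine Finset.sum_congr rfl fun u _ => ?_
    rw [hχθ, AddChar.map_add_eq_mul, AddChar.mulShift_apply, AddChar.mulShift_apply]
  rw [hsum]
  by_cases ha : a = 0
  · by_cases hb : b = 0
    · subst ha hb
      by_cases hθ : θ = 0
      · have : ∑ x : F, χ x * ψ (0 * x + 0 * x⁻¹) = (Fintype.card F : ℂ) - 1 := by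
          rw [← sum_units_eq_sum_mulChar χ fun x => ψ (0 * x + 0 * x⁻¹)]
          simp [hχθ, hθ, Fintype.card_units, Nat.cast_sub Fintype.card_pos]
        rw [this, if_pos ⟨AddChar.mulShift_zero ψ, AddChar.mulShift_zero ψ, hθ⟩]
        simp only [sub_sub_cancel_left, norm_neg, norm_one]
        linarith
      · have hχ1 : χ ≠ 1 := by
          intro h
          apply hθ
          ext u
          have := hχθ u.toMul
          rw [h, MulChar.one_apply_coe] at this
          simpa using this.symm
        simp [hθ, MulChar.sum_eq_zero_of_ne_one hχ1]
    · subst ha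
      rw [if_neg fun h => hzero b hb h.2.1, sub_zero]
      have : ∑ x : F, χ x * ψ (0 * x + b * x⁻¹) = ∑ x : F, χ⁻¹ x * ψ (b * x + 0 * x⁻¹) := by
        refine Fintype.sum_equiv (Equiv.inv F) _ _ fun x => ?_
        simp [MulChar.inv_apply']
      rw [this]
      exact norm_sum_mulChar_mul_addChar_le χ⁻¹ hψ hb 0
  · rw [if_neg fun h => hzero a ha h.1, sub_zero]
    exact norm_sum_mulChar_mul_addChar_le χ hψ ha b

/-- The indicator function of the elements of `U` lying in none of the `H p` with `p ∈ s`. -/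
def sieveIndicator {A ι : Type*} [AddCommGroup A] (U : AddSubgroup A)
    (H : ι → AddSubgroup A) (s : Finset ι) (a : A) : ℂ :=
  (if a ∈ U then 1 else 0) * ∏ p ∈ s, ((if a ∈ U then 1 else 0) - if a ∈ H p then 1 else 0)

lemma mem_of_sieveIndicator_ne_zero {A ι : Type*} [AddCommGroup A] {U : AddSubgroup A}
    {H : ι → AddSubgroup A} {s : Finset ι} {a : A} (h : sieveIndicator U H s a ≠ 0) :
    a ∈ U ∧ ∀ p ∈ s, a ∉ H p := by
  rw [sieveIndicator] at h
  have hU : a ∈ U := by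
    by_contra hU
    simp [hU] at h
  refine ⟨hU, fun p hp hpa => ?_⟩
  exact Finset.prod_ne_zero_iff.1 (right_ne_zero_of_mul h) p hp (by simp [hU, hpa])

section Fourier

variable {A : Type*} [AddCommGroup A] [Fintype A]

/-- The Fourier coefficients of the indicator function of a subgroup `H` of a finite abelian
group. -/
def AddSubgroup.fourierCoeff (H : AddSubgroup A) (ψ : AddChar A ℂ) : ℝ :=
  if ∀ h ∈ H, ψ h = 1 then (Nat.card H : ℝ) / Fintype.card A else 0

lemma AddSubgroup.sum_fourierCoeff_mul (H : AddSubgroup A) (a : A) :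
    ∑ ψ : AddChar A ℂ, (H.fourierCoeff ψ : ℂ) * ψ a = if a ∈ H then 1 else 0 := by
  have hA : (Fintype.card A : ℂ) ≠ 0 := by exact_mod_cast Fintype.card_ne_zero
  have hcoeff : ∀ ψ : AddChar A ℂ,
      (H.fourierCoeff ψ : ℂ) = (∑ h : H, ψ h) / Fintype.card A := by
    intro ψ
    have h := AddChar.sum_eq_ite (ψ.compAddMonoidHom H.subtype)
    have hiff : ψ.compAddMonoidHom H.subtype = 0 ↔ ∀ h ∈ H, ψ h = 1 := by
      rw [AddChar.eq_zero_iff]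
      simp
    simp only [AddChar.compAddMonoidHom_apply, AddSubgroup.subtype_apply, hiff] at h
    rw [h, AddSubgroup.fourierCoeff]
    split_ifs <;> simp
  simp only [hcoeff, div_mul_eq_mul_div, Finset.sum_mul]
  rw [← Finset.sum_div, Finset.sum_comm]
  simp only [← AddChar.map_add_eq_mul, AddChar.sum_apply_eq_ite]
  by_cases ha : a ∈ H
  · rw [if_pos ha, Finset.sum_eq_single (-⟨a, ha⟩ : H)]
    · simp [hA]
    · intro h _ hne
      rw [if_neg]
      intro h0
      apply hne
      ext
      simpa using eq_neg_of_add_eq_zero_left h0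
    · simp
  · rw [if_neg ha, Finset.sum_eq_zero, zero_div]
    intro h _
    rw [if_neg]
    intro h0
    apply ha
    rw [← neg_eq_of_add_eq_zero_right h0]
    exact H.neg_mem h.2

lemma AddSubgroup.sum_fourierCoeff (H : AddSubgroup A) :
    ∑ ψ : AddChar A ℂ, H.fourierCoeff ψ = 1 := by
  have h := H.sum_fourierCoeff_mul 0
  simp only [AddChar.map_zero_eq_one, mul_one, H.zero_mem, if_true] at h
  exact_mod_cast h

/-- The function `φ` is a combination of characters whose coefficients have total absolute
value at most `B`. -/
def HasFourierBound (φ : A → ℂ) (B : ℝ) : Prop :=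
  ∃ c : AddChar A ℂ → ℂ, (∀ a, φ a = ∑ ψ, c ψ * ψ a) ∧ ∑ ψ, ‖c ψ‖ ≤ B

lemma HasFourierBound.mul {φ φ' : A → ℂ} {B B' : ℝ} (h : HasFourierBound φ B)
    (h' : HasFourierBound φ' B') : HasFourierBound (fun a => φ a * φ' a) (B * B') := by
  obtain ⟨c, hc, hB⟩ := h
  obtain ⟨c', hc', hB'⟩ := h'
  refine ⟨fun ψ => ∑ ω, c ω * c' (ψ - ω), fun a => ?_, ?_⟩
  · simp only [hc, hc', Finset.sum_mul]
    rw [Finset.sum_comm]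
    refine Finset.sum_congr rfl fun ω _ => ?_
    rw [Finset.mul_sum]
    refine Fintype.sum_equiv (Equiv.addRight ω) _ _ fun ψ => ?_
    simp only [Equiv.coe_addRight, add_sub_cancel_right, AddChar.add_apply]
    ring
  · calc ∑ ψ, ‖∑ ω, c ω * c' (ψ - ω)‖ ≤ ∑ ψ, ∑ ω, ‖c ω‖ * ‖c' (ψ - ω)‖ := by
          refine Finset.sum_le_sum fun ψ _ => (norm_sum_le _ _).trans_eq ?_
          simp
      _ = (∑ ω, ‖c ω‖) * ∑ ψ, ‖c' ψ‖ := by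
          rw [Finset.sum_comm, Finset.sum_mul]
          refine Finset.sum_congr rfl fun ω _ => ?_
          rw [Finset.mul_sum]
          exact Fintype.sum_equiv (Equiv.subRight ω) _ _ fun ψ => rfl
      _ ≤ B * B' := by
          have h0 : 0 ≤ ∑ ω, ‖c ω‖ := Finset.sum_nonneg fun _ _ => norm_nonneg _
          have h0' : 0 ≤ ∑ ω, ‖c' ω‖ := Finset.sum_nonneg fun _ _ => norm_nonneg _
          exact mul_le_mul hB hB' h0' (h0.trans hB)

lemma AddSubgroup.hasFourierBound_indicator (U : AddSubgroup A) :
    HasFourierBound (fun a => if a ∈ U then 1 else 0) 1 := by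
  refine ⟨fun ψ => U.fourierCoeff ψ, fun a => (U.sum_fourierCoeff_mul a).symm, ?_⟩
  rw [← U.sum_fourierCoeff]
  refine Finset.sum_le_sum fun ψ _ => le_of_eq ?_
  rw [Complex.norm_real, Real.norm_of_nonneg]
  unfold AddSubgroup.fourierCoeff
  split_ifs <;> positivity

lemma AddSubgroup.hasFourierBound_indicator_sub {U H : AddSubgroup A} (hHU : H ≤ U) :
    HasFourierBound (fun a => (if a ∈ U then 1 else 0) - if a ∈ H then 1 else 0)
      (2 * (1 - (Nat.card H : ℝ) / Nat.card U)) := by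
  refine ⟨fun ψ => U.fourierCoeff ψ - H.fourierCoeff ψ, fun a => ?_, ?_⟩
  · simp only [sub_mul, Finset.sum_sub_distrib, AddSubgroup.sum_fourierCoeff_mul]
  · have hU : (0 : ℝ) < Nat.card U := by exact_mod_cast Nat.card_pos
    have hA : (0 : ℝ) < Fintype.card A := by exact_mod_cast Fintype.card_pos
    have hle : (Nat.card H : ℝ) ≤ Nat.card U := by
      exact_mod_cast AddSubgroup.card_le_of_le hHU
    have key : ∀ ψ : AddChar A ℂ, ‖(U.fourierCoeff ψ : ℂ) - H.fourierCoeff ψ‖ =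
        H.fourierCoeff ψ - U.fourierCoeff ψ +
          2 * (1 - (Nat.card H : ℝ) / Nat.card U) * U.fourierCoeff ψ := by
      intro ψ
      rw [← Complex.ofReal_sub, Complex.norm_real, Real.norm_eq_abs]
      unfold AddSubgroup.fourierCoeff
      by_cases h1 : ∀ h ∈ U, ψ h = 1
      · have h2 : ∀ h ∈ H, ψ h = 1 := fun h hh => h1 h (hHU hh)
        rw [if_pos h1, if_pos h2, abs_of_nonneg]
        · field_simp
          ring
        · rw [sub_nonneg]
          gcongr
      · rw [if_neg h1]
        split_ifs
        · rw [zero_sub, abs_neg, abs_of_nonneg (by positivity)]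
          ring
        · simp
    simp only [key]
    rw [Finset.sum_add_distrib, Finset.sum_sub_distrib, ← Finset.mul_sum]
    simp [AddSubgroup.sum_fourierCoeff]

lemma hasFourierBound_sieveIndicator {ι : Type*} {U : AddSubgroup A} {H : ι → AddSubgroup A}
    {s : Finset ι} (hH : ∀ p ∈ s, H p ≤ U) :
    HasFourierBound (sieveIndicator U H s)
      (2 ^ s.card * ∏ p ∈ s, (1 - (Nat.card (H p) : ℝ) / Nat.card U)) := by
  induction s using Finset.induction_on with
  | empty =>
    convert U.hasFourierBound_indicator using 1
    · funext a
      simp [sieveIndicator]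
    · simp
  | insert p s hp ih =>
    have h := (ih fun p' hp' => hH p' (Finset.mem_insert_of_mem hp')).mul
      (AddSubgroup.hasFourierBound_indicator_sub (hH p (Finset.mem_insert_self p s)))
    convert h using 1
    · funext a
      rw [sieveIndicator, sieveIndicator, Finset.prod_insert hp]
      ring
    · rw [Finset.prod_insert hp, Finset.card_insert_of_notMem hp]
      ring

lemma sum_sieveIndicator {ι : Type*} {U : AddSubgroup A} {H : ι → AddSubgroup A}
    {s : Finset ι}
    (hcard : ∀ t ⊆ s, (Nat.card {a : A // a ∈ U ∧ ∀ p ∈ t, a ∈ H p} : ℝ) =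
      Nat.card U * ∏ p ∈ t, ((Nat.card (H p) : ℝ) / Nat.card U)) :
    ∑ a, sieveIndicator U H s a =
      ((Nat.card U * ∏ p ∈ s, (1 - (Nat.card (H p) : ℝ) / Nat.card U) : ℝ) : ℂ) := by
  have h : ∀ a, sieveIndicator U H s a = ∑ t ∈ s.powerset,
      (-1) ^ t.card * (if a ∈ U ∧ ∀ p ∈ t, a ∈ H p then 1 else 0) := by
    intro a
    rw [sieveIndicator]
    by_cases hU : a ∈ U
    · simp only [hU, if_true, one_mul, true_and, Finset.prod_sub, Finset.prod_const_one, mul_one,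
        Finset.prod_boole]
    · simp [hU]
  have hsum : ∀ t ⊆ s, ∑ a : A, (if a ∈ U ∧ ∀ p ∈ t, a ∈ H p then (1 : ℂ) else 0) =
      ((Nat.card U * ∏ p ∈ t, ((Nat.card (H p) : ℝ) / Nat.card U) : ℝ) : ℂ) := by
    intro t ht
    rw [← hcard t ht, Finset.sum_boole, Nat.card_eq_fintype_card, Fintype.card_subtype]
    simp
  simp only [h]
  rw [Finset.sum_comm, Finset.prod_sub, Finset.mul_sum, Complex.ofReal_sum]
  refine Finset.sum_congr rfl fun t ht => ?_
  rw [← Finset.mul_sum, hsum t (Finset.mem_powerset.1 ht)]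
  push_cast
  simp only [Finset.prod_const_one]
  ring

end Fourier

lemma sum_mul_sum_mul_sum {ι₁ ι₂ ι₃ R : Type*} [Fintype ι₁] [Fintype ι₂] [Fintype ι₃]
    [CommRing R] (f₁ : ι₁ → R) (f₂ : ι₂ → R) (f₃ : ι₃ → R) :
    (∑ i, f₁ i) * (∑ i, f₂ i) * ∑ i, f₃ i = ∑ i, ∑ j, ∑ l, f₁ i * f₂ j * f₃ l := by
  rw [Finset.sum_mul_sum, Finset.sum_mul]
  refine Finset.sum_congr rfl fun i _ => ?_
  rw [Finset.sum_mul]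
  exact Finset.sum_congr rfl fun j _ => Finset.mul_sum _ _ _

lemma norm_sum_units_sub_mean_le {F : Type*} [Field F] [Fintype F] {φ₁ φ₂ : F → ℂ}
    {φ₃ : Additive Fˣ → ℂ} {B₁ B₂ B₃ : ℝ} (h₁ : HasFourierBound φ₁ B₁)
    (h₂ : HasFourierBound φ₂ B₂) (h₃ : HasFourierBound φ₃ B₃) :
    ‖∑ u : Fˣ, φ₁ u * φ₂ (u⁻¹ : F) * φ₃ (Additive.ofMul u) -
      Fintype.card F * (((∑ a, φ₁ a) / Fintype.card F) * ((∑ a, φ₂ a) / Fintype.card F) *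
        ((∑ a, φ₃ a) / Fintype.card (Additive Fˣ)))‖ ≤
      2 * √(Fintype.card F) * (B₁ * B₂ * B₃) := by
  obtain ⟨c₁, hc₁, hB₁⟩ := h₁
  obtain ⟨c₂, hc₂, hB₂⟩ := h₂
  obtain ⟨c₃, hc₃, hB₃⟩ := h₃
  have hmean : ∀ {A : Type _} [AddCommGroup A] [Fintype A] {φ : A → ℂ} {c : AddChar A ℂ → ℂ},
      (∀ a, φ a = ∑ ψ, c ψ * ψ a) → (∑ a, φ a) / Fintype.card A = c 0 := by
    intro A _ _ φ c h
    have hA : (Fintype.card A : ℂ) ≠ 0 := by exact_mod_cast Fintype.card_ne_zero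
    rw [div_eq_iff hA]
    simp only [h]
    rw [Finset.sum_comm]
    simp only [← Finset.mul_sum, AddChar.sum_eq_ite]
    simp
  have hmain : (Fintype.card F : ℂ) * (c₁ 0 * c₂ 0 * c₃ 0) = ∑ ψ₁, ∑ ψ₂, ∑ θ,
      c₁ ψ₁ * c₂ ψ₂ * c₃ θ *
        (if ψ₁ = 0 ∧ ψ₂ = 0 ∧ θ = 0 then (Fintype.card F : ℂ) else 0) := by
    simp only [ite_and, mul_ite, mul_zero]
    rw [Finset.sum_eq_single 0, Finset.sum_eq_single 0] <;> simp +contextual [mul_comm]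
  have hexp : ∑ u : Fˣ, φ₁ u * φ₂ (u⁻¹ : F) * φ₃ (Additive.ofMul u) = ∑ ψ₁, ∑ ψ₂, ∑ θ,
      c₁ ψ₁ * c₂ ψ₂ * c₃ θ * ∑ u : Fˣ, ψ₁ u * ψ₂ (u⁻¹ : F) * θ (Additive.ofMul u) := by
    simp only [hc₁, hc₂, hc₃, sum_mul_sum_mul_sum]
    rw [Finset.sum_comm]
    refine Finset.sum_congr rfl fun ψ₁ _ => ?_
    rw [Finset.sum_comm]
    refine Finset.sum_congr rfl fun ψ₂ _ => ?_
    rw [Finset.sum_comm]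
    refine Finset.sum_congr rfl fun θ _ => ?_
    rw [Finset.mul_sum]
    exact Finset.sum_congr rfl fun u _ => by ring
  rw [hmean hc₁, hmean hc₂, hmean hc₃, hmain, hexp]
  simp only [← Finset.sum_sub_distrib, ← mul_sub]
  calc _ ≤ ∑ ψ₁, ∑ ψ₂, ∑ θ, ‖c₁ ψ₁‖ * ‖c₂ ψ₂‖ * ‖c₃ θ‖ * (2 * √(Fintype.card F)) := by
        refine (norm_sum_le _ _).trans (Finset.sum_le_sum fun ψ₁ _ => ?_)
        refine (norm_sum_le _ _).trans (Finset.sum_le_sum fun ψ₂ _ => ?_)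
        refine (norm_sum_le _ _).trans (Finset.sum_le_sum fun θ _ => ?_)
        rw [norm_mul, norm_mul, norm_mul]
        exact mul_le_mul_of_nonneg_left (norm_sum_units_sub_le ψ₁ ψ₂ θ) (by positivity)
    _ = 2 * √(Fintype.card F) * ((∑ ψ, ‖c₁ ψ‖) * (∑ ψ, ‖c₂ ψ‖) * ∑ θ, ‖c₃ θ‖) := by
        rw [sum_mul_sum_mul_sum]
        simp only [← Finset.sum_mul]
        ring
    _ ≤ _ := by
        have h0 : ∀ {A : Type _} [AddCommGroup A] [Fintype A] (c : AddChar A ℂ → ℂ),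
          0 ≤ ∑ ω, ‖c ω‖ := fun c => Finset.sum_nonneg fun _ _ => norm_nonneg _
        have := h0 c₁
        have := h0 c₂
        have := h0 c₃
        have := (h0 c₁).trans hB₁
        have := (h0 c₂).trans hB₂
        gcongr

/-- The subgroups `H p` are proper in `U` and the events of lying in them are independent for
the uniform distribution on `U`. -/
structure IsIndependentSieve {A ι : Type*} [AddCommGroup A] (U : AddSubgroup A)
    (H : ι → AddSubgroup A) (s : Finset ι) : Prop where
  le : ∀ p ∈ s, H p ≤ U
  card_lt : ∀ p ∈ s, Nat.card (H p) < Nat.card U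
  card_eq : ∀ t ⊆ s, (Nat.card {a : A // a ∈ U ∧ ∀ p ∈ t, a ∈ H p} : ℝ) =
    Nat.card U * ∏ p ∈ t, ((Nat.card (H p) : ℝ) / Nat.card U)

lemma IsIndependentSieve.prod_pos {A ι : Type*} [AddCommGroup A] [Fintype A]
    {U : AddSubgroup A} {H : ι → AddSubgroup A} {s : Finset ι} (h : IsIndependentSieve U H s) :
    0 < ∏ p ∈ s, (1 - (Nat.card (H p) : ℝ) / Nat.card U) := by
  refine Finset.prod_pos fun p hp => ?_
  have hU : (0 : ℝ) < Nat.card U := by exact_mod_cast Nat.card_pos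
  rw [sub_pos, div_lt_one hU]
  exact_mod_cast h.card_lt p hp

lemma exists_unit_of_isIndependentSieve {F ι κ : Type*} [Field F] [Fintype F]
    {U : AddSubgroup F} {H : ι → AddSubgroup F} {s : Finset ι}
    {V : AddSubgroup (Additive Fˣ)} {K : κ → AddSubgroup (Additive Fˣ)} {t : Finset κ}
    (hs : IsIndependentSieve U H s) (ht : IsIndependentSieve V K t)
    (hlt : 2 * (2 ^ s.card * (Fintype.card F / Nat.card U : ℝ)) ^ 2 *
      (2 ^ t.card * (Fintype.card (Additive Fˣ) / Nat.card V : ℝ)) < √(Fintype.card F)) :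
    ∃ u : Fˣ, ((u : F) ∈ U ∧ ∀ p ∈ s, (u : F) ∉ H p) ∧
      ((u⁻¹ : F) ∈ U ∧ ∀ p ∈ s, (u⁻¹ : F) ∉ H p) ∧
      (Additive.ofMul u ∈ V ∧ ∀ p ∈ t, Additive.ofMul u ∉ K p) := by
  have hbound := norm_sum_units_sub_mean_le (hasFourierBound_sieveIndicator hs.le)
    (hasFourierBound_sieveIndicator hs.le) (hasFourierBound_sieveIndicator ht.le)
  rw [sum_sieveIndicator hs.card_eq, sum_sieveIndicator ht.card_eq] at hbound
  have hP := hs.prod_pos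
  have hP' := ht.prod_pos
  set P := ∏ p ∈ s, (1 - (Nat.card (H p) : ℝ) / Nat.card U)
  set P' := ∏ p ∈ t, (1 - (Nat.card (K p) : ℝ) / Nat.card V)
  have hU : (0 : ℝ) < Nat.card U := by exact_mod_cast Nat.card_pos
  have hV : (0 : ℝ) < Nat.card V := by exact_mod_cast Nat.card_pos
  have hF : (0 : ℝ) < Fintype.card F := by exact_mod_cast Fintype.card_pos
  have hF' : (0 : ℝ) < Fintype.card (Additive Fˣ) := by exact_mod_cast Fintype.card_pos
  have hne : ∑ u : Fˣ, sieveIndicator U H s u * sieveIndicator U H s (u⁻¹ : F) *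
      sieveIndicator V K t (Additive.ofMul u) ≠ 0 := by
    intro h0
    rw [h0, zero_sub, norm_neg] at hbound
    have hnorm : ‖(Fintype.card F : ℂ) * (((Nat.card U * P : ℝ) : ℂ) / Fintype.card F *
        (((Nat.card U * P : ℝ) : ℂ) / Fintype.card F) *
        (((Nat.card V * P' : ℝ) : ℂ) / Fintype.card (Additive Fˣ)))‖ =
        (Fintype.card F : ℝ) * ((Nat.card U * P / Fintype.card F) *
          (Nat.card U * P / Fintype.card F) * (Nat.card V * P' / Fintype.card (Additive Fˣ))) := by
      simp only [norm_mul, norm_div, Complex.norm_real, Complex.norm_natCast, Real.norm_eq_abs]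
      rw [abs_of_pos hP, abs_of_pos hP']
      simp
    rw [hnorm] at hbound
    refine absurd hbound (not_le.2 ?_)
    have hsq : (Fintype.card F : ℝ) = √(Fintype.card F) * √(Fintype.card F) :=
      (Real.mul_self_sqrt hF.le).symm
    have hS : 0 < √(Fintype.card F : ℝ) := Real.sqrt_pos.2 hF
    set C := (Nat.card U * P / Fintype.card F) * (Nat.card U * P / Fintype.card F) *
      (Nat.card V * P' / Fintype.card (Additive Fˣ)) with hC
    have hCpos : 0 < C := by positivity
    have h := mul_lt_mul_of_pos_right hlt (mul_pos hS hCpos)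
    calc 2 * √(Fintype.card F) * (2 ^ s.card * P * (2 ^ s.card * P) * (2 ^ t.card * P'))
        = 2 * (2 ^ s.card * (Fintype.card F / Nat.card U : ℝ)) ^ 2 *
          (2 ^ t.card * (Fintype.card (Additive Fˣ) / Nat.card V : ℝ)) *
            (√(Fintype.card F) * C) := by
          rw [hC]
          field_simp
      _ < √(Fintype.card F) * (√(Fintype.card F) * C) := h
      _ = Fintype.card F * C := by rw [← mul_assoc, ← hsq]
  obtain ⟨u, -, hu⟩ := Finset.exists_ne_zero_of_sum_ne_zero hne
  exact ⟨u, mem_of_sieveIndicator_ne_zero (left_ne_zero_of_mul (left_ne_zero_of_mul hu)),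
    mem_of_sieveIndicator_ne_zero (right_ne_zero_of_mul (left_ne_zero_of_mul hu)),
    mem_of_sieveIndicator_ne_zero (right_ne_zero_of_mul hu)⟩

/-! ### The sieve for multiplicative orders -/

/-- The elements of the additive group `A` killed by `d`. -/
def AddSubgroup.torsionDvd (A : Type*) [AddCommGroup A] (d : ℕ) : AddSubgroup A :=
  (nsmulAddMonoidHom (α := A) d).ker

lemma AddSubgroup.mem_torsionDvd {A : Type*} [AddCommGroup A] {d : ℕ} {a : A} :
    a ∈ AddSubgroup.torsionDvd A d ↔ d • a = 0 := Iff.rfl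

lemma AddSubgroup.card_torsionDvd {A : Type*} [AddCommGroup A] [Fintype A] [IsAddCyclic A]
    {d : ℕ} (hd : d ∣ Fintype.card A) : Nat.card (AddSubgroup.torsionDvd A d) = d := by
  rw [AddSubgroup.torsionDvd, IsAddCyclic.card_nsmulAddMonoidHom_ker, Nat.card_eq_fintype_card,
    Nat.gcd_eq_right hd]

lemma isIndependentSieve_torsionDvd {A : Type*} [AddCommGroup A] [Fintype A] [IsAddCyclic A]
    {N : ℕ} (hN : N ∣ Fintype.card A) :
    IsIndependentSieve (AddSubgroup.torsionDvd A N)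
      (fun p => AddSubgroup.torsionDvd A (N / p)) N.primeFactors := by
  have hN0 : N ≠ 0 := fun h => Fintype.card_ne_zero (zero_dvd_iff.1 (h ▸ hN))
  have hcard : ∀ d, d ∣ N → Nat.card (AddSubgroup.torsionDvd A d) = d := fun d hd =>
    AddSubgroup.card_torsionDvd (hd.trans hN)
  have hdvd : ∀ p ∈ N.primeFactors, p ∣ N := fun p hp => Nat.dvd_of_mem_primeFactors hp
  refine ⟨fun p hp a ha => ?_, fun p hp => ?_, fun t ht => ?_⟩
  · rw [AddSubgroup.mem_torsionDvd] at ha ⊢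
    rw [← Nat.mul_div_cancel' (hdvd p hp), mul_nsmul', ha, nsmul_zero]
  · rw [hcard _ (Nat.div_dvd_of_dvd (hdvd p hp)), hcard N dvd_rfl]
    exact Nat.div_lt_self (Nat.pos_of_ne_zero hN0) (Nat.prime_of_mem_primeFactors hp).one_lt
  · have hprod : ∀ e, (∀ p ∈ t, p ∣ e) → ∏ p ∈ t, p ∣ e := fun e he =>
      Finset.prod_primes_dvd e (fun p hp => (Nat.prime_of_mem_primeFactors (ht hp)).prime) he
    have hset : ∀ a : A, (a ∈ AddSubgroup.torsionDvd A N ∧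
        ∀ p ∈ t, a ∈ AddSubgroup.torsionDvd A (N / p)) ↔
        a ∈ AddSubgroup.torsionDvd A (N / ∏ p ∈ t, p) := by
      intro a
      simp only [AddSubgroup.mem_torsionDvd, ← addOrderOf_dvd_iff_nsmul_eq_zero]
      constructor
      · rintro ⟨⟨e, he⟩, h⟩
        have ho : 0 < addOrderOf a := addOrderOf_pos a
        rw [he, Nat.mul_div_assoc]
        · exact dvd_mul_right _ _
        · refine hprod e fun p hp => ?_
          have := Nat.mul_dvd_of_dvd_div (hdvd p (ht hp)) (h p hp)
          rw [he, mul_comm] at this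
          exact Nat.dvd_of_mul_dvd_mul_left ho this
      · intro h
        have hd := hprod N fun p hp => hdvd p (ht hp)
        refine ⟨h.trans (Nat.div_dvd_of_dvd hd), fun p hp => h.trans ?_⟩
        exact Nat.div_dvd_div_left hd (Finset.dvd_prod_of_mem _ hp)
    have hd := hprod N fun p hp => hdvd p (ht hp)
    rw [Nat.card_congr (Equiv.subtypeEquivRight hset), hcard _ (Nat.div_dvd_of_dvd hd),
      hcard N dvd_rfl, Nat.cast_div_charZero hd, div_eq_mul_inv, Nat.cast_prod,
      ← Finset.prod_inv_distrib]
    congr 1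
    refine Finset.prod_congr rfl fun p hp => ?_
    have hNR : (N : ℝ) ≠ 0 := by exact_mod_cast hN0
    rw [hcard _ (Nat.div_dvd_of_dvd (hdvd p (ht hp))), Nat.cast_div_charZero (hdvd p (ht hp))]
    field_simp

lemma addOrderOf_eq_of_mem_torsionDvd {A : Type*} [AddCommGroup A] {N : ℕ} (hN : N ≠ 0) {a : A}
    (ha : a ∈ AddSubgroup.torsionDvd A N)
    (h : ∀ p ∈ N.primeFactors, a ∉ AddSubgroup.torsionDvd A (N / p)) : addOrderOf a = N := by
  refine addOrderOf_eq_of_nsmul_and_div_prime_nsmul (Nat.pos_of_ne_zero hN) ha fun p hp hpN => ?_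
  exact h p (Nat.mem_primeFactors.2 ⟨hp, hpN, hN⟩)

/-! ### The sieve for `F_q`-orders -/

lemma isCoprime_of_mem_normalizedFactors {K : Type*} [Field K] {m : K[X]} (hm : m ≠ 0) {p p' : K[X]}
    (hp : p ∈ normalizedFactors m) (hp' : p' ∈ normalizedFactors m) (hne : p ≠ p') :
    IsCoprime p p' := by
  rw [Polynomial.mem_normalizedFactors_iff hm] at hp hp'
  rw [hp.1.coprime_iff_not_dvd]
  exact fun h => hne (eq_of_monic_of_associated hp.2.1 hp'.2.1 (hp.1.associated_of_dvd hp'.1 h))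

section FqOrder

variable {K L : Type*} [Field K] [Fintype K] [Field L] [Algebra K L]

lemma frobenius_pow_apply (i : ℕ) (β : L) :
    ((FiniteField.frobeniusAlgHom K L).toLinearMap ^ i) β = β ^ Fintype.card K ^ i := by
  rw [Module.End.pow_apply]
  have : ⇑(FiniteField.frobeniusAlgHom K L).toLinearMap = (· ^ Fintype.card K) := rfl
  rw [this, pow_iterate]

lemma aeval_frobenius_apply (h : K[X]) (β : L) :
    aeval (FiniteField.frobeniusAlgHom K L).toLinearMap h β = polyAct (Fintype.card K) h β := by
  rw [aeval_eq_sum_range, polyAct, Polynomial.sum_over_range _ (by simp), LinearMap.sum_apply]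
  refine Finset.sum_congr rfl fun i _ => ?_
  rw [LinearMap.smul_apply, frobenius_pow_apply, Algebra.smul_def]

variable (L) in
/-- The kernel of the action of a polynomial over a finite field on an extension field. -/
def polyActKer (h : K[X]) : Submodule K L :=
  LinearMap.ker (aeval (FiniteField.frobeniusAlgHom K L).toLinearMap h)

lemma mem_polyActKer {h : K[X]} {β : L} :
    β ∈ polyActKer L h ↔ polyAct (Fintype.card K) h β = 0 := by
  rw [polyActKer, LinearMap.mem_ker, aeval_frobenius_apply]

variable (K) in
/-- The ideal of polynomials annihilating an element of the extension field. -/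
def polyActAnnihilator (β : L) : Ideal K[X] where
  carrier := {h | β ∈ polyActKer L h}
  zero_mem' := by simp [polyActKer]
  add_mem' := by
    intro f h hf hh
    simp only [polyActKer, Set.mem_ofPred_eq, LinearMap.mem_ker] at hf hh ⊢
    rw [map_add, LinearMap.add_apply, hf, hh, add_zero]
  smul_mem' := by
    intro f h hh
    simp only [polyActKer, Set.mem_ofPred_eq, LinearMap.mem_ker] at hh ⊢
    rw [smul_eq_mul, map_mul, Module.End.mul_apply, hh, map_zero]

variable (K) in
lemma exists_forall_mem_polyActKer_iff_dvd (β : L) :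
    ∃ o : K[X], ∀ h : K[X], β ∈ polyActKer L h ↔ o ∣ h :=
  ⟨Submodule.IsPrincipal.generator (polyActAnnihilator K β), fun _ =>
    Submodule.IsPrincipal.mem_iff_generator_dvd (polyActAnnihilator K β)⟩

lemma finrank_polyActKer_le [Fintype L] {h : K[X]} (h0 : h ≠ 0) :
    Module.finrank K (polyActKer L h) ≤ h.natDegree := by
  have hK : 1 < Fintype.card K := Fintype.one_lt_card
  set P : L[X] := ∑ i ∈ Finset.range (h.natDegree + 1),
    C (algebraMap K L (h.coeff i)) * X ^ Fintype.card K ^ i with hP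
  have hPeval : ∀ β, P.eval β = polyAct (Fintype.card K) h β := by
    intro β
    rw [hP, eval_finsetSum, polyAct, Polynomial.sum_over_range _ (by simp)]
    simp
  have hPdeg : P.natDegree ≤ Fintype.card K ^ h.natDegree := by
    refine natDegree_sum_le_of_forall_le _ _ fun i hi => (natDegree_C_mul_X_pow_le _ _).trans ?_
    exact Nat.pow_le_pow_right hK.le (Nat.lt_succ_iff.1 (Finset.mem_range.1 hi))
  have hP0 : P ≠ 0 := by
    intro hzero
    have hc : P.coeff (Fintype.card K ^ h.natDegree) = algebraMap K L h.leadingCoeff := by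
      rw [hP, finsetSum_coeff, Finset.sum_eq_single h.natDegree]
      · simp
      · intro i _ hi
        rw [coeff_C_mul_X_pow, if_neg]
        exact fun h' => hi (Nat.pow_right_injective hK h').symm
      · simp
    rw [hzero, coeff_zero, eq_comm, map_eq_zero, leadingCoeff_eq_zero] at hc
    exact h0 hc
  have hcard : Fintype.card (polyActKer L h) ≤ Fintype.card K ^ h.natDegree := by
    rw [Fintype.card_subtype]
    refine (card_le_degree_of_subset_roots fun β hβ => ?_).trans hPdeg
    rw [mem_roots hP0, IsRoot, hPeval, ← mem_polyActKer]
    simpa using hβ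
  rw [Module.card_eq_pow_finrank (K := K)] at hcard
  exact (Nat.pow_le_pow_iff_right hK).1 hcard

lemma aeval_frobenius_X_pow_sub_one [Fintype L] :
    aeval (FiniteField.frobeniusAlgHom K L).toLinearMap
      (X ^ Module.finrank K L - 1 : K[X]) = 0 := by
  ext β
  rw [map_sub, map_pow, aeval_X, map_one, LinearMap.sub_apply, frobenius_pow_apply,
    ← Module.card_eq_pow_finrank, FiniteField.pow_card]
  simp

lemma natCard_polyActKer [Fintype L] {h : K[X]} (hh : h ∣ X ^ Module.finrank K L - 1) :
    Nat.card (polyActKer L h) = Fintype.card K ^ h.natDegree := by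
  have hfin : FiniteDimensional K L := Module.Finite.of_finite
  have hn : 0 < Module.finrank K L := Module.finrank_pos
  have hne : (X ^ Module.finrank K L - 1 : K[X]) ≠ 0 := (monic_X_pow_sub_C 1 hn.ne').ne_zero
  rw [Nat.card_eq_fintype_card, Module.card_eq_pow_finrank (K := K)]
  congr 1
  obtain ⟨h', hh'⟩ := hh
  rw [hh'] at hne
  have h1 := finrank_polyActKer_le (L := L) (left_ne_zero_of_mul hne)
  have h2 := finrank_polyActKer_le (L := L) (right_ne_zero_of_mul hne)
  have hdeg : h.natDegree + h'.natDegree = Module.finrank K L := by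
    rw [← natDegree_mul (left_ne_zero_of_mul hne) (right_ne_zero_of_mul hne), ← hh']
    exact natDegree_X_pow_sub_C
  have hrange := LinearMap.finrank_range_add_finrank_ker
    (aeval (FiniteField.frobeniusAlgHom K L).toLinearMap h')
  have hle : LinearMap.range (aeval (FiniteField.frobeniusAlgHom K L).toLinearMap h') ≤
      polyActKer L h := by
    rintro _ ⟨β, rfl⟩
    rw [polyActKer, LinearMap.mem_ker, ← Module.End.mul_apply, ← map_mul, ← hh',
      aeval_frobenius_X_pow_sub_one, LinearMap.zero_apply]
  have h3 := Submodule.finrank_mono hle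
  rw [polyActKer] at h1 h2 h3 ⊢
  omega

lemma isIndependentSieve_polyActKer [Fintype L] {m : K[X]}
    (hm : m ∣ X ^ Module.finrank K L - 1) :
    IsIndependentSieve (polyActKer L m).toAddSubgroup
      (fun p => (polyActKer L (m / p)).toAddSubgroup) (normalizedFactors m).toFinset := by
  have hne : (X ^ Module.finrank K L - 1 : K[X]) ≠ 0 :=
    (monic_X_pow_sub_C 1 Module.finrank_pos.ne').ne_zero
  have hm0 : m ≠ 0 := ne_zero_of_dvd_ne_zero hne hm
  have hK : 1 < Fintype.card K := Fintype.one_lt_card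
  have hcard : ∀ d, d ∣ m → Nat.card (polyActKer L d).toAddSubgroup =
      Fintype.card K ^ d.natDegree := fun d hd => natCard_polyActKer (hd.trans hm)
  have hfac : ∀ p ∈ (normalizedFactors m).toFinset, Irreducible p ∧ p.Monic ∧ p ∣ m :=
    fun p hp => (Polynomial.mem_normalizedFactors_iff hm0).1 (Multiset.mem_toFinset.1 hp)
  have hmul : ∀ d, d ∣ m → d * (m / d) = m := fun d hd =>
    EuclideanDomain.mul_div_cancel' (ne_zero_of_dvd_ne_zero hm0 hd) hd
  have hdivdvd : ∀ d, d ∣ m → m / d ∣ m := fun d hd => ⟨d, by rw [mul_comm, hmul d hd]⟩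
  have hdeg : ∀ d, d ∣ m → d.natDegree + (m / d).natDegree = m.natDegree := fun d hd => by
    have h0 : d * (m / d) ≠ 0 := by rwa [hmul d hd]
    rw [← natDegree_mul (left_ne_zero_of_mul h0) (right_ne_zero_of_mul h0), hmul d hd]
  have hle : ∀ d d' : K[X], d ∣ d' → polyActKer L d ≤ polyActKer L d' := by
    intro d d' hd a ha
    obtain ⟨o, ho⟩ := exists_forall_mem_polyActKer_iff_dvd K a
    rw [ho] at ha ⊢
    exact ha.trans hd
  refine ⟨fun p hp => hle _ _ (hdivdvd p (hfac p hp).2.2), fun p hp => ?_, fun t ht => ?_⟩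
  · rw [hcard _ (hdivdvd p (hfac p hp).2.2), hcard m dvd_rfl]
    refine Nat.pow_lt_pow_right hK ?_
    have := hdeg p (hfac p hp).2.2
    have := (hfac p hp).1.natDegree_pos
    omega
  · have hprod : ∀ e, (∀ p ∈ t, p ∣ e) → ∏ p ∈ t, p ∣ e := fun e he =>
      Finset.prod_dvd_of_coprime (fun p hp p' hp' hpp' =>
        isCoprime_of_mem_normalizedFactors hm0 (Multiset.mem_toFinset.1 (ht hp))
          (Multiset.mem_toFinset.1 (ht hp')) hpp') he
    have hd := hprod m fun p hp => (hfac p (ht hp)).2.2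
    have hset : ∀ a : L, (a ∈ (polyActKer L m).toAddSubgroup ∧
        ∀ p ∈ t, a ∈ (polyActKer L (m / p)).toAddSubgroup) ↔
        a ∈ (polyActKer L (m / ∏ p ∈ t, p)).toAddSubgroup := by
      intro a
      obtain ⟨o, ho⟩ := exists_forall_mem_polyActKer_iff_dvd K a
      simp only [Submodule.mem_toAddSubgroup, ho]
      constructor
      · rintro ⟨⟨e, he⟩, h⟩
        have ho0 : o ≠ 0 := fun h0 => hm0 (by rw [he, h0, zero_mul])
        obtain ⟨e', he'⟩ : ∏ p ∈ t, p ∣ e := by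
          refine hprod e fun p hp => ?_
          have := mul_dvd_mul_left p (h p hp)
          rw [hmul p (hfac p (ht hp)).2.2, he, mul_comm] at this
          exact (mul_dvd_mul_iff_left ho0).1 this
        refine ⟨e', ?_⟩
        have hprod0 : ∏ p ∈ t, p ≠ 0 := ne_zero_of_dvd_ne_zero hm0 hd
        refine mul_left_cancel₀ hprod0 ?_
        rw [hmul _ hd, he, he']
        ring
      · intro h
        refine ⟨h.trans (hdivdvd _ hd), fun p hp => h.trans ?_⟩
        have hpm := (hfac p (ht hp)).2.2
        obtain ⟨e, he⟩ := Finset.dvd_prod_of_mem (fun p => p) hp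
        refine ⟨e, mul_left_cancel₀ (hfac p (ht hp)).1.ne_zero ?_⟩
        rw [hmul p hpm]
        nth_rw 1 [← hmul _ hd]
        rw [he]
        ring
    have hK0 : (Fintype.card K : ℝ) ≠ 0 := by exact_mod_cast (by omega : Fintype.card K ≠ 0)
    have hquot : ∀ d, d ∣ m → ((Fintype.card K ^ (m / d).natDegree : ℕ) : ℝ) =
        (Fintype.card K : ℝ) ^ m.natDegree * ((Fintype.card K : ℝ) ^ d.natDegree)⁻¹ := by
      intro d hd
      rw [← hdeg d hd, pow_add]
      push_cast
      field_simp
    rw [Nat.card_congr (Equiv.subtypeEquivRight hset), hcard _ (hdivdvd _ hd), hcard m dvd_rfl,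
      hquot _ hd, natDegree_prod_of_monic _ _ fun p hp => (hfac p (ht hp)).2.1,
      ← Finset.prod_pow_eq_pow_sum, ← Finset.prod_inv_distrib, Nat.cast_pow]
    congr 1
    refine Finset.prod_congr rfl fun p hp => ?_
    have hpm := (hfac p (ht hp)).2.2
    rw [hcard _ (hdivdvd p hpm), hquot p hpm]
    field_simp

lemma isFqOrder_of_mem_polyActKer {m : K[X]} (hmonic : m.Monic) {n : ℕ} (hm : m ∣ X ^ n - 1)
    {a : L} (ha : a ∈ polyActKer L m)
    (h : ∀ p ∈ (normalizedFactors m).toFinset, a ∉ polyActKer L (m / p)) :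
    IsFqOrder (Fintype.card K) n m a := by
  refine ⟨hmonic, hm, mem_polyActKer.1 ha, fun h' hmonic' _ hh' => ?_⟩
  obtain ⟨o, ho⟩ := exists_forall_mem_polyActKer_iff_dvd K a
  rw [← mem_polyActKer, ho] at hh'
  obtain ⟨e, he⟩ := (ho m).1 ha
  have hunit : IsUnit e := by
    by_contra hunit
    obtain ⟨p, hpm, hp, e', rfl⟩ := exists_monic_irreducible_factor e hunit
    refine h p ?_ ((ho _).2 ⟨e', ?_⟩)
    · rw [Multiset.mem_toFinset, Polynomial.mem_normalizedFactors_iff hmonic.ne_zero]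
      exact ⟨hp, hpm, ⟨o * e', by rw [he]; ring⟩⟩
    · rw [he, mul_left_comm, mul_div_cancel_left₀ _ hpm.ne_zero]
  refine natDegree_le_of_dvd ?_ hmonic'.ne_zero
  rw [he]
  exact (hunit.mul_right_dvd).2 hh'

end FqOrder

/-! ### Counting squarefree divisors -/

lemma finite_setOf_monic_dvd {K : Type*} [Field K] {f : K[X]} (hf : f ≠ 0) :
    {g : K[X] | g.Monic ∧ Squarefree g ∧ g ∣ f}.Finite := by
  refine ((normalizedFactors f).powerset.toFinset.image Multiset.prod).finite_toSet.subset ?_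
  rintro g ⟨hg, -, hgf⟩
  rw [Finset.mem_coe, Finset.mem_image]
  refine ⟨normalizedFactors g, ?_, hg.prod_normalizedFactors_eq_self⟩
  rw [Multiset.mem_toFinset, Multiset.mem_powerset]
  exact (dvd_iff_normalizedFactors_le_normalizedFactors hg.ne_zero hf).1 hgf

lemma two_pow_card_le_Wpoly {K : Type*} [Field K] {f : K[X]} (hf : f ≠ 0) {s : Finset K[X]}
    (hs : s ⊆ (normalizedFactors f).toFinset) : 2 ^ s.card ≤ Wpoly f := by
  have hfac : ∀ p ∈ s, Irreducible p ∧ p.Monic ∧ p ∣ f := fun p hp =>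
    (Polynomial.mem_normalizedFactors_iff hf).1 (Multiset.mem_toFinset.1 (hs hp))
  have hcop : ∀ p ∈ s, ∀ p' ∈ s, p ≠ p' → IsCoprime p p' := fun p hp p' hp' =>
    isCoprime_of_mem_normalizedFactors hf (Multiset.mem_toFinset.1 (hs hp))
      (Multiset.mem_toFinset.1 (hs hp'))
  have hmem : ∀ t ⊆ s, ∀ t' ⊆ s, ∏ p ∈ t, p = ∏ p ∈ t', p → t ⊆ t' := by
    intro t ht t' ht' h p hp
    have hdvd : p ∣ ∏ p ∈ t', p := h ▸ Finset.dvd_prod_of_mem (fun p => p) hp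
    obtain ⟨p', hp', hpp'⟩ := (hfac p (ht hp)).1.prime.exists_mem_finset_dvd hdvd
    by_cases hne : p = p'
    · rwa [hne]
    · exact absurd hpp' ((hfac p (ht hp)).1.coprime_iff_not_dvd.1
        (hcop p (ht hp) p' (ht' hp') hne))
  have hinj : Set.InjOn (fun t : Finset K[X] => ∏ p ∈ t, p) s.powerset := by
    intro t ht t' ht' h
    rw [Finset.mem_coe, Finset.mem_powerset] at ht ht'
    exact (hmem t ht t' ht' h).antisymm (hmem t' ht' t ht h.symm)
  rw [← Finset.card_powerset, ← Finset.card_image_of_injOn hinj, Wpoly, ← Set.ncard_coe_finset]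
  refine Set.ncard_le_ncard ?_ (finite_setOf_monic_dvd hf)
  intro g hg
  rw [Finset.mem_coe, Finset.mem_image] at hg
  obtain ⟨t, ht, rfl⟩ := hg
  rw [Finset.mem_powerset] at ht
  refine ⟨monic_prod_of_monic _ _ fun p hp => (hfac p (ht hp)).2.1, ?_, ?_⟩
  · refine Finset.squarefree_prod_of_pairwise_isCoprime (fun p hp p' hp' hne => ?_)
      fun p hp => (hfac p (ht hp)).1.squarefree
    exact (hcop p (ht hp) p' (ht hp') hne).isRelPrime
  · exact Finset.prod_dvd_of_coprime (fun p hp p' hp' hne => hcop p (ht hp) p' (ht hp') hne)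
      fun p hp => (hfac p (ht hp)).2.2

lemma two_pow_card_sdiff_le_Wpoly {K : Type*} [Field K] {f g : K[X]} (hf : f ≠ 0)
    (hgf : g ∣ f) :
    2 ^ ((normalizedFactors f).toFinset \ (normalizedFactors g).toFinset).card ≤
      Wpoly (radPoly f / radPoly g) := by
  have hg : g ≠ 0 := ne_zero_of_dvd_ne_zero hf hgf
  have hsub : (normalizedFactors g).toFinset ⊆ (normalizedFactors f).toFinset := by
    rw [Multiset.toFinset_subset]
    exact Multiset.subset_of_le ((dvd_iff_normalizedFactors_le_normalizedFactors hg hf).1 hgf)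
  have hfac : ∀ p ∈ (normalizedFactors f).toFinset, Irreducible p ∧ p.Monic ∧ p ∣ f :=
    fun p hp => (Polynomial.mem_normalizedFactors_iff hf).1 (Multiset.mem_toFinset.1 hp)
  have hrad : radPoly f / radPoly g =
      ∏ p ∈ (normalizedFactors f).toFinset \ (normalizedFactors g).toFinset, p := by
    rw [radPoly, radPoly, ← Finset.prod_sdiff hsub]
    refine mul_div_cancel_right₀ _ (Finset.prod_ne_zero_iff.2 fun p hp => ?_)
    exact (hfac p (hsub hp)).1.ne_zero
  have h0 : radPoly f / radPoly g ≠ 0 := by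
    rw [hrad]
    exact Finset.prod_ne_zero_iff.2 fun p hp => (hfac p (Finset.mem_sdiff.1 hp).1).1.ne_zero
  refine two_pow_card_le_Wpoly h0 fun p hp => ?_
  rw [Multiset.mem_toFinset, Polynomial.mem_normalizedFactors_iff h0]
  have hp' := hfac p (Finset.mem_sdiff.1 hp).1
  exact ⟨hp'.1, hp'.2.1, hrad ▸ Finset.dvd_prod_of_mem (fun p => p) hp⟩

lemma card_toFinset_normalizedFactors_le_natDegree {K : Type*} [Field K] {g : K[X]}
    (hg : g.Monic) : (normalizedFactors g).toFinset.card ≤ g.natDegree := by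
  rw [← hg.sum_count_mul_natDegree, Finset.card_eq_sum_ones]
  refine Finset.sum_le_sum fun p hp => ?_
  rw [Multiset.mem_toFinset] at hp
  have h1 := Multiset.count_pos.2 hp
  have h2 := ((Polynomial.mem_normalizedFactors_iff hg.ne_zero).1 hp).1.natDegree_pos
  exact Nat.mul_pos h1 h2

lemma squarefree_X_pow_sub_one_of_coprime_card {K : Type*} [Field K] [Fintype K] {n : ℕ}
    (hn : Nat.gcd (Fintype.card K) n = 1) : Squarefree (X ^ n - 1 : K[X]) := by
  refine Separable.squarefree (X_pow_sub_one_separable_iff.2 fun h0 => ?_)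
  obtain ⟨p, hchar, e, hp, he⟩ := FiniteField.card' K
  rw [CharP.cast_eq_zero_iff K p] at h0
  have : p ∣ Nat.gcd (Fintype.card K) n :=
    Nat.dvd_gcd (he ▸ dvd_pow_self p e.ne_zero) h0
  rw [hn] at this
  exact hp.one_lt.ne' (Nat.dvd_one.1 this)

lemma two_pow_card_normalizedFactors_le {K : Type*} [Field K] [Fintype K] {n : ℕ}
    (hn : 0 < n) {g m : K[X]} (hg : g.Monic) (hgm : g * m = X ^ n - 1) :
    2 ^ (normalizedFactors m).toFinset.card ≤
      Wpoly (radPoly (X ^ n - 1 : K[X]) / radPoly g) *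
        if Nat.gcd (Fintype.card K) n = 1 then 1 else Fintype.card K ^ g.natDegree := by
  have hf : (X ^ n - 1 : K[X]) ≠ 0 := (monic_X_pow_sub_C 1 hn.ne').ne_zero
  have hm0 : m ≠ 0 := right_ne_zero_of_mul (hgm ▸ hf)
  have hmf : m ∣ X ^ n - 1 := ⟨g, by rw [← hgm, mul_comm]⟩
  have hW := two_pow_card_sdiff_le_Wpoly hf ⟨m, hgm.symm⟩
  have hsub : (normalizedFactors m).toFinset ⊆ (normalizedFactors (X ^ n - 1 : K[X])).toFinset := by
    rw [Multiset.toFinset_subset]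
    exact Multiset.subset_of_le ((dvd_iff_normalizedFactors_le_normalizedFactors hm0 hf).1 hmf)
  split_ifs with hcop
  · rw [mul_one]
    refine le_trans (Nat.pow_le_pow_right two_pos (Finset.card_le_card fun p hp => ?_)) hW
    rw [Finset.mem_sdiff]
    refine ⟨hsub hp, fun hpg => ?_⟩
    rw [Multiset.mem_toFinset] at hp hpg
    rw [Polynomial.mem_normalizedFactors_iff hm0] at hp
    rw [Polynomial.mem_normalizedFactors_iff hg.ne_zero] at hpg
    have hpp : p * p ∣ X ^ n - 1 := hgm ▸ mul_dvd_mul hpg.2.2 hp.2.2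
    exact hp.1.not_isUnit (squarefree_X_pow_sub_one_of_coprime_card hcop p hpp)
  · have hle : (normalizedFactors m).toFinset.card ≤
        ((normalizedFactors (X ^ n - 1 : K[X])).toFinset \ (normalizedFactors g).toFinset).card +
          g.natDegree := by
      have h1 := Finset.card_le_card hsub
      have h2 := Finset.card_le_card_sdiff_add_card
        (t := (normalizedFactors g).toFinset) (s := (normalizedFactors (X ^ n - 1 : K[X])).toFinset)
      have h3 := card_toFinset_normalizedFactors_le_natDegree hg
      omega
    refine (Nat.pow_le_pow_right two_pos hle).trans ?_
    rw [pow_add]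
    exact Nat.mul_le_mul hW (Nat.pow_le_pow_left Fintype.one_lt_card _)

lemma two_pow_card_primeFactors_div_le {M r : ℕ} (hM : M ≠ 0) (hr : r ∣ M) :
    2 ^ (M / r).primeFactors.card ≤ Wnat (radN M / radN r) * radN r := by
  have hsub : r.primeFactors ⊆ M.primeFactors := Nat.primeFactors_mono hr hM
  have hrad0 : radN r ≠ 0 :=
    Finset.prod_ne_zero_iff.2 fun p hp => (Nat.prime_of_mem_primeFactors hp).ne_zero
  have hrad : radN M / radN r = ∏ p ∈ M.primeFactors \ r.primeFactors, p := by
    rw [radN, ← Finset.prod_sdiff hsub]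
    exact Nat.mul_div_cancel _ (Nat.pos_of_ne_zero hrad0)
  have hprime : ∀ p ∈ M.primeFactors \ r.primeFactors, p.Prime := fun p hp =>
    Nat.prime_of_mem_primeFactors (Finset.mem_sdiff.1 hp).1
  have hR0 : radN M / radN r ≠ 0 := by
    rw [hrad]
    exact Finset.prod_ne_zero_iff.2 fun p hp => (hprime p hp).ne_zero
  have hW : Wnat (radN M / radN r) = 2 ^ (M.primeFactors \ r.primeFactors).card := by
    have hfac : (normalizedFactors (radN M / radN r)).toFinset =
        M.primeFactors \ r.primeFactors := by
      rw [← Nat.primeFactors_prod hprime, ← hrad, Nat.factors_eq, List.toFinset_coe]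
      rfl
    rw [Wnat, Finset.card_def, Nat.divisors_filter_squarefree hR0, Multiset.card_map,
      ← Finset.card_def, Finset.card_powerset, hfac]
  have hradle : 2 ^ r.primeFactors.card ≤ radN r :=
    Finset.pow_card_le_prod _ _ _ fun p hp => (Nat.prime_of_mem_primeFactors hp).two_le
  have hle : (M / r).primeFactors.card ≤
      (M.primeFactors \ r.primeFactors).card + r.primeFactors.card := by
    have h1 := Finset.card_le_card (Nat.primeFactors_mono (Nat.div_dvd_of_dvd hr) hM)
    have h2 := Finset.card_le_card_sdiff_add_card (t := r.primeFactors) (s := M.primeFactors)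
    omega
  refine (Nat.pow_le_pow_right two_pos hle).trans ?_
  rw [pow_add, hW]
  exact Nat.mul_le_mul_left _ hradle

/-- If `q^{n/2 - ϑ} > 2·r·rad(r)·W(x^n-1)·W(R)·W(G)`, where `ϑ = 2k` if
`gcd(q,n) = 1` and `ϑ = 3k` otherwise, then there exists `α ∈ F_{q^n}^*` such that
both `α` and `α⁻¹` are simultaneously `r`-primitive and `k`-normal over `F_q`. -/
theorem exists_r_primitive_k_normal_pair_of_inequality
    (q n r k : ℕ) (hq : IsPrimePow q) (hn : 0 < n) (hr : 0 < r)
    (hrdvd : r ∣ q ^ n - 1)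
    (Fq F : Type*) [Field Fq] [Field F] [Fintype Fq] [Fintype F] [Algebra Fq F]
    (hcard : Fintype.card Fq = q) (hdim : Module.finrank Fq F = n)
    (g : Fq[X]) (hgm : g.Monic) (hgd : g.natDegree = k)
    (hgdvd : g ∣ (X ^ n - 1 : Fq[X]))
    (hineq : (q : ℝ) ^ ((n : ℝ) / 2 -
        (if Nat.gcd q n = 1 then 2 * k else 3 * k : ℕ)) >
      2 * r * radN r * Wpoly (X ^ n - 1 : Fq[X]) *
        Wnat (radN (q ^ n - 1) / radN r) *
        Wpoly (radPoly (X ^ n - 1 : Fq[X]) / radPoly g)) :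
    ∃ α : F, α ≠ 0 ∧ orderOf α = (q ^ n - 1) / r ∧ orderOf α⁻¹ = (q ^ n - 1) / r ∧
      IsKNormal Fq q n k α ∧ IsKNormal Fq q n k α⁻¹ := by
  have hF : Fintype.card F = q ^ n := by
    rw [Module.card_eq_pow_finrank (K := Fq), hcard, hdim]
  have hunits : Fintype.card (Additive Fˣ) = q ^ n - 1 := by
    rw [← hF, ← Fintype.card_units]
    exact Fintype.card_congr Additive.toMul
  have hM0 : q ^ n - 1 ≠ 0 := hunits ▸ Fintype.card_ne_zero
  have hf : (X ^ n - 1 : Fq[X]).Monic := monic_X_pow_sub_C 1 hn.ne'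
  obtain ⟨m, hm⟩ := hgdvd
  have hmmonic : m.Monic := hgm.of_mul_monic_left (hm ▸ hf)
  have hmdvd : m ∣ X ^ n - 1 := ⟨g, by rw [hm, mul_comm]⟩
  have hmdeg : k + m.natDegree = n := by
    rw [← hgd, ← hgm.natDegree_mul hmmonic, ← hm]
    exact natDegree_X_pow_sub_C
  have hrM : r * ((q ^ n - 1) / r) = q ^ n - 1 := Nat.mul_div_cancel' hrdvd
  have hN0 : (q ^ n - 1) / r ≠ 0 := right_ne_zero_of_mul (hrM.symm ▸ hM0)
  have hNdvd : (q ^ n - 1) / r ∣ Fintype.card (Additive Fˣ) := by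
    rw [hunits]
    exact Nat.div_dvd_of_dvd hrdvd
  have hsieve := isIndependentSieve_polyActKer (K := Fq) (L := F) (hdim.symm ▸ hmdvd)
  have hsieve' := isIndependentSieve_torsionDvd hNdvd
  have hcardU : Nat.card (polyActKer F m).toAddSubgroup = q ^ m.natDegree :=
    hcard ▸ natCard_polyActKer (K := Fq) (L := F) (hdim.symm ▸ hmdvd)
  have hcardV := AddSubgroup.card_torsionDvd hNdvd
  have hq0 : (0 : ℝ) < q := by exact_mod_cast hq.pos
  have hratio : (Fintype.card F : ℝ) / Nat.card (polyActKer F m).toAddSubgroup = q ^ k := by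
    rw [hcardU, hF, ← hmdeg, pow_add]
    push_cast
    field_simp
  have hratio' : (Fintype.card (Additive Fˣ) : ℝ) /
      Nat.card (AddSubgroup.torsionDvd (Additive Fˣ) ((q ^ n - 1) / r)) = r := by
    rw [hcardV, hunits, div_eq_iff (by exact_mod_cast hN0)]
    exact_mod_cast hrM.symm
  have hlt : 2 * (2 ^ (normalizedFactors m).toFinset.card *
      (Fintype.card F / Nat.card (polyActKer F m).toAddSubgroup : ℝ)) ^ 2 *
      (2 ^ ((q ^ n - 1) / r).primeFactors.card * (Fintype.card (Additive Fˣ) /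
        Nat.card (AddSubgroup.torsionDvd (Additive Fˣ) ((q ^ n - 1) / r)) : ℝ)) <
      √(Fintype.card F) := by
    rw [hratio, hratio', hF]
    have hW₁ : (2 : ℝ) ^ (normalizedFactors m).toFinset.card ≤ Wpoly (X ^ n - 1 : Fq[X]) := by
      have hsub : (normalizedFactors m).toFinset ⊆
          (normalizedFactors (X ^ n - 1 : Fq[X])).toFinset := by
        rw [Multiset.toFinset_subset]
        exact Multiset.subset_of_le
          ((dvd_iff_normalizedFactors_le_normalizedFactors hmmonic.ne_zero hf.ne_zero).1 hmdvd)
      exact_mod_cast two_pow_card_le_Wpoly hf.ne_zero hsub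
    have hW₂ := two_pow_card_normalizedFactors_le hn hgm hm.symm
    rw [hcard, hgd] at hW₂
    have hW₂' : (2 : ℝ) ^ (normalizedFactors m).toFinset.card ≤
        Wpoly (radPoly (X ^ n - 1 : Fq[X]) / radPoly g) *
          (if Nat.gcd q n = 1 then 1 else q ^ k : ℕ) := by exact_mod_cast hW₂
    have hW₃ : (2 : ℝ) ^ ((q ^ n - 1) / r).primeFactors.card ≤
        Wnat (radN (q ^ n - 1) / radN r) * radN r := by
      exact_mod_cast two_pow_card_primeFactors_div_le hM0 hrdvd
    have hsqrt : √((q ^ n : ℕ) : ℝ) = (q : ℝ) ^ ((n : ℝ) / 2) := by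
      rw [Real.sqrt_eq_rpow, Nat.cast_pow, ← Real.rpow_natCast, ← Real.rpow_mul hq0.le]
      congr 1
      ring
    rw [Real.rpow_sub hq0, ← hsqrt, Real.rpow_natCast, gt_iff_lt, lt_div_iff₀ (by positivity)]
      at hineq
    have hpow : (q : ℝ) ^ (if Nat.gcd q n = 1 then 2 * k else 3 * k) =
        ((if Nat.gcd q n = 1 then 1 else q ^ k : ℕ) : ℝ) * q ^ (2 * k) := by
      split_ifs
      · simp
      · push_cast
        ring
    rw [hpow] at hineq
    refine lt_of_le_of_lt ?_ hineq
    calc _ = 2 * r * q ^ (2 * k) * ((2 : ℝ) ^ (normalizedFactors m).toFinset.card *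
          2 ^ (normalizedFactors m).toFinset.card) *
          2 ^ ((q ^ n - 1) / r).primeFactors.card := by ring
      _ ≤ 2 * r * q ^ (2 * k) * (Wpoly (X ^ n - 1 : Fq[X]) *
          (Wpoly (radPoly (X ^ n - 1 : Fq[X]) / radPoly g) *
            (if Nat.gcd q n = 1 then 1 else q ^ k : ℕ))) *
          (Wnat (radN (q ^ n - 1) / radN r) * radN r) := by gcongr
      _ = _ := by ring
  obtain ⟨u, hu, hu', hord⟩ := exists_unit_of_isIndependentSieve hsieve hsieve' hlt
  have horder : orderOf (u : F) = (q ^ n - 1) / r := by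
    rw [orderOf_units, ← addOrderOf_ofMul_eq_orderOf]
    exact addOrderOf_eq_of_mem_torsionDvd hN0 hord.1 hord.2
  have hnormal : ∀ a : F, (a ∈ (polyActKer F m).toAddSubgroup ∧
      ∀ p ∈ (normalizedFactors m).toFinset, a ∉ (polyActKer F (m / p)).toAddSubgroup) →
      IsKNormal Fq q n k a := fun a ha =>
    ⟨m, hcard ▸ isFqOrder_of_mem_polyActKer hmmonic hmdvd ha.1 ha.2, by omega⟩
  refine ⟨u, u.ne_zero, horder, ?_, hnormal _ hu, hnormal _ hu'⟩
  rw [← Units.val_inv_eq_inv_val, orderOf_units, orderOf_inv, ← orderOf_units, horder]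

end
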